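/- Let H be an ordered graph on h vertices with interval chromatic number χ<(H)=2. For every η>0 there exists n₀∈ℕ such that every ordered graph G on n ≥ n₀ vertices with n divisible by h and minimum degree δ(G) ≥ (1 − min{α*(H), 1/2} + η)n contains a perfect H-tiling. -/

import Mathlib

open Finset

section Defs

variable {h n : ℕ}

/-- `φ` is an order-preserving embedding of the ordered graph `H` into the ordered graph `G`:
a strictly increasing map carrying edges of `H` to edges of `G`. -/
def IsOrderedCopy (H : SimpleGraph (Fin h)) (G : SimpleGraph (Fin n))
    (φ : Fin h → Fin n) : Prop :=
  StrictMono φ ∧ ∀ i j : Fin h, H.Adj i j → G.Adj (φ i) (φ j)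

/-- `S` is the vertex set of a copy of the ordered graph `H` in the ordered graph `G`. -/
def IsCopySet (H : SimpleGraph (Fin h)) (G : SimpleGraph (Fin n))
    (S : Finset (Fin n)) : Prop :=
  ∃ φ : Fin h → Fin n, IsOrderedCopy H G φ ∧ Finset.image φ Finset.univ = S

/-- `G` has an `H`-tiling (vertex-disjoint copies of `H`) whose copies exactly cover the
vertex set `S`; equivalently, the induced ordered subgraph `G[S]` has a perfect `H`-tiling. -/
def HasPerfectTilingOn (H : SimpleGraph (Fin h)) (G : SimpleGraph (Fin n))
    (S : Finset (Fin n)) : Prop :=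
  ∃ 𝒯 : Finset (Finset (Fin n)),
    (∀ T ∈ 𝒯, IsCopySet H G T) ∧
    (𝒯 : Set (Finset (Fin n))).PairwiseDisjoint id ∧
    𝒯.biUnion id = S

/-- `G` has a perfect `H`-tiling. -/
def HasPerfectTiling (H : SimpleGraph (Fin h)) (G : SimpleGraph (Fin n)) : Prop :=
  HasPerfectTilingOn H G Finset.univ

/-- The degree of a vertex in an ordered graph. -/
noncomputable def odeg (G : SimpleGraph (Fin n)) (v : Fin n) : ℕ :=
  (G.neighborSet v).ncard

/-- `[h]` can be partitioned into `k` intervals, each independent in `H`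
(expressed via a monotone colouring with independent fibres). -/
def HasIntervalColoring (H : SimpleGraph (Fin h)) (k : ℕ) : Prop :=
  ∃ c : Fin h → Fin k, Monotone c ∧ ∀ i j : Fin h, H.Adj i j → c i ≠ c j

/-- The interval chromatic number `χ<(H)` of an ordered graph. -/
noncomputable def intervalChi (H : SimpleGraph (Fin h)) : ℕ :=
  sInf {k | HasIntervalColoring H k}

/-- `α⁺ᵢ(H)`: `α⁺₀ = 0`, and `α⁺_{i+1}` is the largest `k ≤ h` such that the interval
`[α⁺ᵢ + 1, k]` is independent in `H` (vertices are 1-indexed via `v ↦ (v : ℕ) + 1`). -/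
noncomputable def alphaPlus (H : SimpleGraph (Fin h)) : ℕ → ℕ
  | 0 => 0
  | (i + 1) => sSup {k | k ≤ h ∧ ∀ a b : Fin h,
      alphaPlus H i + 1 ≤ (a : ℕ) + 1 → (a : ℕ) + 1 ≤ k →
      alphaPlus H i + 1 ≤ (b : ℕ) + 1 → (b : ℕ) + 1 ≤ k → ¬ H.Adj a b}

/-- `α⁻ᵢ(H)`: `α⁻₀ = h + 1`, and `α⁻_{i+1}` is the smallest `k ≥ 1` such that the interval
`[k, α⁻ᵢ − 1]` is independent in `H`. -/
noncomputable def alphaMinus (H : SimpleGraph (Fin h)) : ℕ → ℕ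
  | 0 => h + 1
  | (i + 1) => sInf {k | 1 ≤ k ∧ ∀ a b : Fin h,
      k ≤ (a : ℕ) + 1 → (a : ℕ) + 1 ≤ alphaMinus H i - 1 →
      k ≤ (b : ℕ) + 1 → (b : ℕ) + 1 ≤ alphaMinus H i - 1 → ¬ H.Adj a b}

/-- `α*(H) = min over 1 ≤ ℓ < χ<(H) of min{α⁺_ℓ/(ℓh), (h − α⁻_ℓ + 1)/(ℓh)}`. -/
noncomputable def alphaStar (H : SimpleGraph (Fin h)) : ℝ :=
  sInf {x : ℝ | ∃ ℓ : ℕ, 1 ≤ ℓ ∧ ℓ < intervalChi H ∧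
    (x = (alphaPlus H ℓ : ℝ) / (ℓ * h) ∨
     x = ((h : ℝ) - alphaMinus H ℓ + 1) / (ℓ * h))}

/-- `α*(H)` for ordered graphs with interval chromatic number 2:
`min{α⁺₁(H)/h, (h − α⁻₁(H) + 1)/h}`. -/
noncomputable def alphaStar2 (H : SimpleGraph (Fin h)) : ℝ :=
  min ((alphaPlus H 1 : ℝ) / h) (((h : ℝ) - alphaMinus H 1 + 1) / h)

/-- Property A: no edges of `H` within `[1, ⌊h/2⌋ + 1]` nor within `[⌈h/2⌉, h]`. -/
def PropertyA (H : SimpleGraph (Fin h)) : Prop :=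
  (∀ a b : Fin h, (a : ℕ) + 1 ≤ h / 2 + 1 → (b : ℕ) + 1 ≤ h / 2 + 1 → ¬ H.Adj a b) ∧
  (∀ a b : Fin h, (h + 1) / 2 ≤ (a : ℕ) + 1 → (h + 1) / 2 ≤ (b : ℕ) + 1 → ¬ H.Adj a b)

/-- Property B: for each partition of `[h]` into nonempty intervals `[1, i], [i+1, h]`
there is an edge of `H` between them. -/
def PropertyB (H : SimpleGraph (Fin h)) : Prop :=
  ∀ i : ℕ, 1 ≤ i → i < h →
    ∃ a b : Fin h, H.Adj a b ∧ (a : ℕ) + 1 ≤ i ∧ i + 1 ≤ (b : ℕ) + 1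

/-- `s(H)`: the smallest vertex adjacent to `h`, and `0` if `h` is isolated. -/
noncomputable def sOG (H : SimpleGraph (Fin h)) : ℕ :=
  sInf {k | ∃ a b : Fin h, H.Adj a b ∧ (a : ℕ) + 1 = k ∧ (b : ℕ) + 1 = h}

open Classical in
/-- `l(H)`: the largest vertex adjacent to `1`, and `h + 1` if `1` is isolated. -/
noncomputable def lOG (H : SimpleGraph (Fin h)) : ℕ :=
  if ∃ a b : Fin h, H.Adj a b ∧ (a : ℕ) + 1 = 1 then
    sSup {k | ∃ a b : Fin h, H.Adj a b ∧ (a : ℕ) + 1 = 1 ∧ (b : ℕ) + 1 = k}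
  else h + 1

/-- The vertex `h` has Property C: `s(H) ≥ 1` and there is an edge within `[s(H), h − 1]`. -/
def PropertyCLast (H : SimpleGraph (Fin h)) : Prop :=
  1 ≤ sOG H ∧ ∃ a b : Fin h, H.Adj a b ∧
    sOG H ≤ (a : ℕ) + 1 ∧ (a : ℕ) + 1 ≤ h - 1 ∧
    sOG H ≤ (b : ℕ) + 1 ∧ (b : ℕ) + 1 ≤ h - 1

/-- The vertex `1` has Property C: `l(H) ≤ h` and there is an edge within `[2, l(H)]`. -/
def PropertyCFirst (H : SimpleGraph (Fin h)) : Prop :=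
  lOG H ≤ h ∧ ∃ a b : Fin h, H.Adj a b ∧
    2 ≤ (a : ℕ) + 1 ∧ (a : ℕ) + 1 ≤ lOG H ∧
    2 ≤ (b : ℕ) + 1 ∧ (b : ℕ) + 1 ≤ lOG H

/-- `S` is an `H`-absorbing set for `W`: both `G[S]` and `G[S ∪ W]` have perfect `H`-tilings. -/
def IsAbsorbingFor (H : SimpleGraph (Fin h)) (G : SimpleGraph (Fin n))
    (S W : Finset (Fin n)) : Prop :=
  HasPerfectTilingOn H G S ∧ HasPerfectTilingOn H G (S ∪ W)

end Defs

section Regularity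

/-- The density `d(A,B) = e(A,B)/(|A||B|)` of a pair of vertex sets in a graph. -/
noncomputable def pairDensity {V : Type*} (G : SimpleGraph V) (A B : Finset V) : ℝ :=
  ({e : V × V | e.1 ∈ A ∧ e.2 ∈ B ∧ G.Adj e.1 e.2}.ncard : ℝ) /
    ((A.card : ℝ) * (B.card : ℝ))

/-- The pair `(A, B)` is `ε`-regular in `G`. -/
def IsRegularPair {V : Type*} (G : SimpleGraph V) (A B : Finset V) (ε : ℝ) : Prop :=
  ∀ X ⊆ A, ∀ Y ⊆ B, ε * A.card ≤ (X.card : ℝ) → ε * B.card ≤ (Y.card : ℝ) →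
    |pairDensity G A B - pairDensity G X Y| < ε

end Regularity

section Bottle

/-- The chromatic number of a finite graph. -/
noncomputable def chromNum {m : ℕ} (B : SimpleGraph (Fin m)) : ℕ :=
  sInf {k | ∃ c : Fin m → Fin k, ∀ x y : Fin m, B.Adj x y → c x ≠ c y}

/-- `σ(B)`: the smallest size of a colour class in any proper colouring of `B`
with `χ(B)` colours. -/
noncomputable def sigmaMinCl {m : ℕ} (B : SimpleGraph (Fin m)) : ℕ :=
  sInf {c | ∃ C : Fin m → Fin (chromNum B),
    (∀ x y : Fin m, B.Adj x y → C x ≠ C y) ∧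
    ∃ i : Fin (chromNum B), c = (Finset.univ.filter (fun v => C v = i)).card}

/-- The critical chromatic number `χ_cr(B) = (χ(B) − 1)·|B|/(|B| − σ(B))`. -/
noncomputable def critChrom {m : ℕ} (B : SimpleGraph (Fin m)) : ℝ :=
  ((chromNum B : ℝ) - 1) * m / ((m : ℝ) - sigmaMinCl B)

/-- `φ` is an interval labeling of the complete multipartite graph with part function `p`
(with respect to some permutation `σ` of the parts). -/
def IsIntervalLabeling {m k : ℕ} (p : Fin m → Fin k) (φ : Equiv.Perm (Fin m)) : Prop :=
  ∃ σ : Equiv.Perm (Fin k), ∀ x y : Fin m, σ (p x) < σ (p y) → φ x < φ y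

/-- `G` is (an isomorphic realisation of) the ordered blow-up `(B(t), φ)` of the complete
multipartite graph `B` with part function `p`: there is a block assignment `β` whose fibres
all have size `t`, compatible with the order induced by `φ`, with adjacency between blocks
given by `B`. -/
def IsOrderedBlowup {m k : ℕ} (p : Fin m → Fin k) (φ : Equiv.Perm (Fin m)) (t : ℕ)
    {N : ℕ} (G : SimpleGraph (Fin N)) : Prop :=
  ∃ β : Fin N → Fin m,
    (∀ x : Fin m, {u : Fin N | β u = x}.ncard = t) ∧
    (∀ u v : Fin N, u ≤ v → φ (β u) ≤ φ (β v)) ∧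
    (∀ u v : Fin N, G.Adj u v ↔ p (β u) ≠ p (β v))

/-- The complete multipartite graph with part function `p` is a bottlegraph assigned to `H`:
for every interval labeling `φ` there is a `t ≥ 1` such that the ordered blow-up `(B(t), φ)`
has a perfect `H`-tiling. -/
def IsBottlegraph {h m k : ℕ} (H : SimpleGraph (Fin h)) (p : Fin m → Fin k) : Prop :=
  ∀ φ : Equiv.Perm (Fin m), IsIntervalLabeling p φ →
    ∃ t : ℕ, 0 < t ∧ ∀ (N : ℕ) (G : SimpleGraph (Fin N)),
      IsOrderedBlowup p φ t G → HasPerfectTiling H G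

end Bottle

section Robust

variable {V : Type*} [Fintype V] [DecidableEq V]

open Classical in
/-- There are robustly many ways of extending `A` by `s` further vertices, one at a time, to a set
with property `P`: at each step at least `t` choices of the next vertex are available. -/
def RobustlyMany (t : ℝ) (P : Finset V → Prop) : ℕ → Finset V → Prop
  | 0, A => P A
  | s + 1, A => t ≤ (#{v | v ∉ A ∧ RobustlyMany t P s (insert v A)} : ℝ)

namespace RobustlyMany

theorem mono {t t' : ℝ} {P Q : Finset V → Prop} (ht : t' ≤ t) {s : ℕ} {A : Finset V}
    (hPQ : ∀ B, B.card = A.card + s → P B → Q B) (hA : RobustlyMany t P s A) :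
    RobustlyMany t' Q s A := by
  induction s generalizing A with
  | zero => exact hPQ A (by simp) hA
  | succ s ih =>
    refine ht.trans (le_trans hA (Nat.cast_le.2 (card_le_card fun v hv => ?_)))
    simp only [mem_filter, mem_univ, true_and] at hv ⊢
    refine ⟨hv.1, ih (fun B hB => hPQ B ?_) hv.2⟩
    rw [hB, card_insert_of_notMem hv.1]; ring

theorem append {t : ℝ} {P : Finset V → Prop} {s₁ s₂ : ℕ} {A : Finset V}
    (hA : RobustlyMany t (RobustlyMany t P s₂) s₁ A) : RobustlyMany t P (s₁ + s₂) A := by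
  induction s₁ generalizing A with
  | zero => rw [zero_add]; exact hA
  | succ s ih =>
    rw [Nat.succ_add]
    refine le_trans hA (Nat.cast_le.2 (card_le_card fun v hv => ?_))
    simp only [mem_filter, mem_univ, true_and] at hv ⊢
    exact ⟨hv.1, ih hv.2⟩

theorem shift {t : ℝ} {P : Finset V → Prop} {s : ℕ} {A C : Finset V} (hAC : Disjoint A C)
    (hA : RobustlyMany t P s A) :
    RobustlyMany (t - C.card) (fun B => ∃ S, Disjoint S C ∧ B = S ∪ C ∧ P S) s (A ∪ C) := by
  induction s generalizing A with
  | zero => exact ⟨A, hAC, rfl, hA⟩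
  | succ s ih =>
    classical
    unfold RobustlyMany at hA ⊢
    have : #{v | v ∉ A ∧ RobustlyMany t P s (insert v A)} ≤
        #{v | v ∉ A ∪ C ∧ RobustlyMany (t - C.card)
          (fun B => ∃ S, Disjoint S C ∧ B = S ∪ C ∧ P S) s (insert v (A ∪ C))} + C.card := by
      refine le_trans (card_le_card ?_) (card_union_le _ _)
      intro v hv
      simp only [mem_union, mem_filter, mem_univ, true_and] at hv ⊢
      by_cases hvC : v ∈ C
      · exact Or.inr hvC
      · refine Or.inl ⟨by tauto, ?_⟩
        rw [← insert_union]
        exact ih (disjoint_insert_left.2 ⟨hvC, hAC⟩) hv.2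
    have : (#{v | v ∉ A ∧ RobustlyMany t P s (insert v A)} : ℝ) ≤
        #{v | v ∉ A ∪ C ∧ RobustlyMany (t - C.card)
          (fun B => ∃ S, Disjoint S C ∧ B = S ∪ C ∧ P S) s (insert v (A ∪ C))} + C.card := by
      exact_mod_cast this
    linarith

theorem avoid {t : ℝ} {P : Finset V → Prop} {s : ℕ} {A U : Finset V} (hAU : Disjoint A U)
    (hA : RobustlyMany t P s A) :
    RobustlyMany (t - U.card) (fun B => P B ∧ Disjoint B U) s A := by
  induction s generalizing A with
  | zero => exact ⟨hA, hAU⟩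
  | succ s ih =>
    classical
    unfold RobustlyMany at hA ⊢
    have : #{v | v ∉ A ∧ RobustlyMany t P s (insert v A)} ≤
        #{v | v ∉ A ∧ RobustlyMany (t - U.card)
          (fun B => P B ∧ Disjoint B U) s (insert v A)} + U.card := by
      refine le_trans (card_le_card ?_) (card_union_le _ _)
      intro v hv
      simp only [mem_union, mem_filter, mem_univ, true_and] at hv ⊢
      by_cases hvU : v ∈ U
      · exact Or.inr hvU
      · exact Or.inl ⟨hv.1, ih (disjoint_insert_left.2 ⟨hvU, hAU⟩) hv.2⟩
    have : (#{v | v ∉ A ∧ RobustlyMany t P s (insert v A)} : ℝ) ≤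
        #{v | v ∉ A ∧ RobustlyMany (t - U.card)
          (fun B => P B ∧ Disjoint B U) s (insert v A)} + U.card := by
      exact_mod_cast this
    linarith

theorem bind {t t₁ t₂ : ℝ} {P : Finset V → Prop} {Q : Finset V → Finset V → Prop} {s₁ s₂ : ℕ}
    (ht₁ : t ≤ t₁) (ht₂ : t ≤ t₂ - s₁) (hP : RobustlyMany t₁ P s₁ ∅)
    (hQ : ∀ S, S.card = s₁ → P S → RobustlyMany t₂ (Q S) s₂ ∅) :
    RobustlyMany t
      (fun B => ∃ S₁ S₂, Disjoint S₁ S₂ ∧ B = S₁ ∪ S₂ ∧ P S₁ ∧ Q S₁ S₂) (s₁ + s₂) ∅ := by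
  refine append (hP.mono ht₁ fun S hS hPS => ?_)
  simp only [card_empty, zero_add] at hS
  have := (hQ S hS hPS).shift (disjoint_empty_left S)
  rw [empty_union] at this
  refine this.mono (by rwa [hS]) ?_
  rintro B - ⟨S₂, hd, rfl, h⟩
  exact ⟨S, S₂, hd.symm, union_comm _ _, hPS, h⟩

open Classical in
theorem single {t : ℝ} {p : V → Prop} (hp : t ≤ (#{v | p v} : ℝ)) :
    RobustlyMany t (fun B => ∃ v, B = {v} ∧ p v) 1 ∅ := by
  refine hp.trans ?_
  gcongr with v
  intro hv
  exact ⟨notMem_empty v, v, by simp, hv⟩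

theorem subsets (N : Finset V) (s : ℕ) :
    RobustlyMany ((N.card : ℝ) - s) (fun B => B ⊆ N) s ∅ := by
  induction s with
  | zero => exact empty_subset N
  | succ s ih =>
    have h1 : RobustlyMany (N.card : ℝ) (fun B => ∃ v, B = {v} ∧ v ∈ N) 1 ∅ :=
      single (by simp)
    refine (bind (t := (N.card : ℝ) - (s + 1 : ℕ)) (Q := fun _ B => ∃ v, B = {v} ∧ v ∈ N)
      ?_ ?_ ih fun S _ _ => h1).mono le_rfl ?_
    · push_cast; linarith
    · push_cast; linarith
    · rintro B - ⟨S₁, S₂, -, rfl, h, v, rfl, hv⟩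
      exact union_subset h (singleton_subset_iff.2 hv)

open Classical in
/-- Weighted averaging: if each `W ∈ Ω` admits robustly many sets with property `P W`, some single
set has property `P W` for a positive weighted proportion of all `W`. -/
theorem exists_averaging {ι : Type*} {t : ℝ} (ht : 0 ≤ t) {P : ι → Finset V → Prop}
    (wt : ι → ℝ) (hwt : ∀ W, 0 ≤ wt W) {s : ℕ} {A : Finset V} (Ω : Finset ι)
    (hV : 0 < Fintype.card V) (hΩ : ∀ W ∈ Ω, RobustlyMany t (P W) s A) :
    ∃ B, (t / Fintype.card V) ^ s * ∑ W ∈ Ω, wt W ≤ ∑ W ∈ Ω with P W B, wt W := by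
  induction s generalizing A Ω with
  | zero =>
    refine ⟨A, ?_⟩
    rw [filter_true_of_mem (p := fun W => P W A) (fun W hW => hΩ W hW)]
    simp
  | succ s ih =>
    have hn : (0 : ℝ) < Fintype.card V := by exact_mod_cast hV
    let good : ι → V → Prop := fun W v => v ∉ A ∧ RobustlyMany t (P W) s (insert v A)
    obtain ⟨v, hv⟩ : ∃ v, t / Fintype.card V * ∑ W ∈ Ω, wt W ≤ ∑ W ∈ Ω with good W v, wt W := by
      by_contra! hcon
      have : Nonempty V := Fintype.card_pos_iff.1 hV
      have h1 : ∑ v : V, ∑ W ∈ Ω with good W v, wt W < t * ∑ W ∈ Ω, wt W := by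
        calc _ < ∑ _v : V, t / Fintype.card V * ∑ W ∈ Ω, wt W :=
              sum_lt_sum_of_nonempty univ_nonempty fun v _ => hcon v
          _ = _ := by
              rw [sum_const, card_univ, nsmul_eq_mul]; field_simp
      have h2 : ∑ v : V, ∑ W ∈ Ω with good W v, wt W = ∑ W ∈ Ω, (#{v | good W v} : ℝ) * wt W := by
        simp_rw [sum_filter]
        rw [sum_comm]
        refine sum_congr rfl fun W _ => ?_
        rw [← sum_filter, sum_const, nsmul_eq_mul]
      rw [h2, mul_sum] at h1
      refine absurd h1 (not_lt.2 (sum_le_sum fun W hW => ?_))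
      exact mul_le_mul_of_nonneg_right (hΩ W hW) (hwt W)
    obtain ⟨B, hB⟩ := ih (A := insert v A) (Ω.filter (good · v))
      fun W hW => (mem_filter.1 hW).2.2
    refine ⟨B, ?_⟩
    calc _ = (t / Fintype.card V) ^ s * (t / Fintype.card V * ∑ W ∈ Ω, wt W) := by ring
      _ ≤ (t / Fintype.card V) ^ s * ∑ W ∈ Ω with good W v, wt W := by gcongr
      _ ≤ _ := hB
      _ ≤ _ := by
        refine sum_le_sum_of_subset_of_nonneg ?_ fun W _ _ => hwt W
        rw [filter_filter]
        exact fun W hW => by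
          simp only [mem_filter] at hW ⊢
          exact ⟨hW.1, hW.2.2⟩

end RobustlyMany

/-- If each of the sets `N x`, `x ∈ T`, has size at least `2 * c * |V|`, then at least `c * |V|`
vertices lie in at least a proportion `c` of these sets. -/
theorem card_heavy_ge {ι : Type*} (T : Finset ι) (N : ι → Finset V) {c : ℝ} (hc : 0 ≤ c)
    (hc1 : c ≤ 1) (hN : ∀ x ∈ T, 2 * c * Fintype.card V ≤ (N x).card) :
    c * Fintype.card V ≤ (#{v | c * T.card ≤ (#{x ∈ T | v ∈ N x} : ℝ)} : ℝ) := by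
  rcases T.eq_empty_or_nonempty with rfl | hT
  · simp only [card_empty, Nat.cast_zero, mul_zero, filter_empty, le_refl, filter_true, card_univ]
    nlinarith [Nat.cast_nonneg (α := ℝ) (Fintype.card V)]
  have hT0 : (0 : ℝ) < T.card := by exact_mod_cast hT.card_pos
  set F : Finset V := {v | c * T.card ≤ (#{x ∈ T | v ∈ N x} : ℝ)} with hF
  have h1 : ∑ v : V, (#{x ∈ T | v ∈ N x} : ℝ) = ∑ x ∈ T, ((N x).card : ℝ) := by
    simp_rw [card_filter, Nat.cast_sum]
    rw [sum_comm]
    refine sum_congr rfl fun x _ => ?_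
    rw [← Nat.cast_sum, ← card_filter]
    simp
  have h2 : T.card * (2 * c * Fintype.card V) ≤ ∑ v : V, (#{x ∈ T | v ∈ N x} : ℝ) := by
    rw [h1, ← nsmul_eq_mul]
    exact card_nsmul_le_sum _ _ _ hN
  have h3 : ∑ v : V, (#{x ∈ T | v ∈ N x} : ℝ) ≤
      ∑ v : V, (c * T.card + if v ∈ F then (T.card : ℝ) else 0) := by
    refine sum_le_sum fun v _ => ?_
    by_cases hv : v ∈ F
    · rw [if_pos hv]
      have : (#{x ∈ T | v ∈ N x} : ℝ) ≤ T.card := by exact_mod_cast card_filter_le _ _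
      nlinarith
    · rw [if_neg hv, add_zero]
      simp only [hF, mem_filter, mem_univ, true_and, not_le] at hv
      exact hv.le
  rw [sum_add_distrib, sum_const, card_univ, nsmul_eq_mul, ← sum_filter, sum_const,
    filter_mem_eq_inter, univ_inter, nsmul_eq_mul] at h3
  have h4 : (T.card : ℝ) * (c * Fintype.card V) ≤ T.card * F.card := by linarith
  exact le_of_mul_le_mul_left h4 hT0

theorem RobustlyMany.common (T : Finset V) (N : V → Finset V) {c : ℝ} (hc : 0 ≤ c)
    (hc1 : c ≤ 1) (hN : ∀ x ∈ T, 2 * c * Fintype.card V ≤ (N x).card) (k : ℕ) :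
    RobustlyMany (c * Fintype.card V - k)
      (fun B => c ^ k * T.card ≤ (#{x ∈ T | B ⊆ N x} : ℝ)) k ∅ := by
  induction k with
  | zero => simp [RobustlyMany]
  | succ k ih =>
    refine (bind (t := c * Fintype.card V - (k + 1 : ℕ)) (t₂ := c * Fintype.card V)
      (Q := fun S B => ∃ v, B = {v} ∧
        c * #{x ∈ T | S ⊆ N x} ≤ (#{x ∈ {x ∈ T | S ⊆ N x} | v ∈ N x} : ℝ))
      ?_ ?_ ih fun S _ _ => single ?_).mono le_rfl ?_
    · push_cast; linarith
    · push_cast; linarith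
    · exact card_heavy_ge _ N hc hc1 fun x hx => hN x (mem_filter.1 hx).1
    · rintro B - ⟨S, _, -, rfl, h, v, rfl, hv⟩
      rw [filter_filter] at hv
      calc c ^ (k + 1) * T.card = c * (c ^ k * T.card) := by ring
        _ ≤ c * #{x ∈ T | S ⊆ N x} := by gcongr
        _ ≤ _ := hv
        _ = _ := by
          congr 2; ext x
          simp [insert_subset_iff, and_comm]

/-- Dense bipartite incidences contain robustly many complete bipartite configurations. -/
theorem RobustlyMany.bipartite (T : Finset V) (N : V → Finset V) {c t : ℝ} (hc : 0 ≤ c)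
    (hc1 : c ≤ 1) (hN : ∀ x ∈ T, 2 * c * Fintype.card V ≤ (N x).card) (k l : ℕ)
    (ht : t ≤ c * Fintype.card V - k) (ht' : t ≤ c ^ k * T.card - l - k) :
    RobustlyMany t (fun S => ∃ A Q, Disjoint A Q ∧ S = A ∪ Q ∧ A.card = k ∧ Q.card = l ∧
      Q ⊆ T ∧ ∀ x ∈ Q, A ⊆ N x) (k + l) ∅ := by
  refine (bind (Q := fun A Q => A.card = k ∧ Q.card = l ∧ Q ⊆ T ∧ ∀ x ∈ Q, A ⊆ N x)
    (t₂ := c ^ k * T.card - l) ht ht' (common T N hc hc1 hN k)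
    fun A hA h => ?_).mono le_rfl ?_
  · refine (subsets {x ∈ T | A ⊆ N x} l).mono (by linarith) fun B hB hBs => ?_
    refine ⟨hA, by simpa using hB, hBs.trans (filter_subset _ _), fun x hx => ?_⟩
    exact (mem_filter.1 (hBs hx)).2
  · rintro B - ⟨A, Q, hd, rfl, -, h⟩
    exact ⟨A, Q, hd, rfl, h⟩

end Robust

section Tiles

variable {h n : ℕ} {H : SimpleGraph (Fin h)} {G : SimpleGraph (Fin n)}

/-- `H` is contained in the complete bipartite graph between the intervals `[1, i]` and
`[i + 1, h]`, both of which are nonempty. -/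
def IsSplit (H : SimpleGraph (Fin h)) (i : ℕ) : Prop :=
  1 ≤ i ∧ i < h ∧ ∀ a b : Fin h, H.Adj a b → ((a : ℕ) < i ↔ i ≤ (b : ℕ))

theorem IsSplit.isCopySet {i : ℕ} (hi : IsSplit H i) {P Q : Finset (Fin n)} (hP : P.card = i)
    (hQ : Q.card = h - i) (hPQ : ∀ x ∈ P, ∀ y ∈ Q, x < y ∧ G.Adj x y) :
    IsCopySet H G (P ∪ Q) := by
  obtain ⟨-, hlt, hadj⟩ := hi
  let φ : Fin h → Fin n := fun j =>
    if hj : (j : ℕ) < i then P.orderEmbOfFin hP ⟨j, hj⟩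
    else Q.orderEmbOfFin hQ ⟨j - i, by omega⟩
  have hφ1 : ∀ j : Fin h, (j : ℕ) < i → φ j ∈ P := fun j hj => by
    simp only [φ, dif_pos hj]; exact orderEmbOfFin_mem _ _ _
  have hφ2 : ∀ j : Fin h, ¬ (j : ℕ) < i → φ j ∈ Q := fun j hj => by
    simp only [φ, dif_neg hj]; exact orderEmbOfFin_mem _ _ _
  have hmono : StrictMono φ := by
    intro a b hab
    have hab' : (a : ℕ) < b := hab
    by_cases ha : (a : ℕ) < i
    · by_cases hb : (b : ℕ) < i
      · simp only [φ, dif_pos ha, dif_pos hb]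
        exact (P.orderEmbOfFin hP).strictMono (by simpa using hab')
      · exact (hPQ _ (hφ1 a ha) _ (hφ2 b hb)).1
    · have hb : ¬ (b : ℕ) < i := by omega
      simp only [φ, dif_neg ha, dif_neg hb]
      exact (Q.orderEmbOfFin hQ).strictMono (by simp only [Fin.mk_lt_mk]; omega)
  refine ⟨φ, ⟨hmono, fun a b hab => ?_⟩, ?_⟩
  · have h1 := hadj a b hab
    by_cases ha : (a : ℕ) < i
    · exact (hPQ _ (hφ1 a ha) _ (hφ2 b (by omega))).2
    · exact (hPQ _ (hφ1 b (by omega)) _ (hφ2 a ha)).2.symm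
  · refine eq_of_subset_of_card_le ?_ ?_
    · intro x hx
      obtain ⟨j, -, rfl⟩ := mem_image.1 hx
      by_cases hj : (j : ℕ) < i
      · exact mem_union_left _ (hφ1 j hj)
      · exact mem_union_right _ (hφ2 j hj)
    · rw [card_image_of_injective _ hmono.injective, card_univ, Fintype.card_fin]
      refine (card_union_le _ _).trans ?_
      omega

theorem IsCopySet.card {S : Finset (Fin n)} (hS : IsCopySet H G S) : S.card = h := by
  obtain ⟨φ, hφ, rfl⟩ := hS
  rw [card_image_of_injective _ hφ.1.injective, card_univ, Fintype.card_fin]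

theorem IsCopySet.hasPerfectTilingOn {S : Finset (Fin n)} (hS : IsCopySet H G S) :
    HasPerfectTilingOn H G S :=
  ⟨{S}, by simpa using hS, by simp, by simp⟩

theorem hasPerfectTilingOn_empty : HasPerfectTilingOn H G ∅ :=
  ⟨∅, by simp, by simp, by simp⟩

theorem HasPerfectTilingOn.union {A B : Finset (Fin n)} (hA : HasPerfectTilingOn H G A)
    (hB : HasPerfectTilingOn H G B) (hAB : Disjoint A B) : HasPerfectTilingOn H G (A ∪ B) := by
  obtain ⟨𝒜, hA1, hA2, rfl⟩ := hA
  obtain ⟨ℬ, hB1, hB2, rfl⟩ := hB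
  refine ⟨𝒜 ∪ ℬ, ?_, ?_, by rw [union_biUnion]⟩
  · intro T hT
    rcases mem_union.1 hT with hT | hT
    exacts [hA1 T hT, hB1 T hT]
  · rw [coe_union, Set.pairwiseDisjoint_union]
    refine ⟨hA2, hB2, fun S hS T hT _ => ?_⟩
    exact hAB.mono (subset_biUnion_of_mem id hS) (subset_biUnion_of_mem id hT)

theorem HasPerfectTilingOn.biUnion {ι : Type*} [DecidableEq ι] {F : Finset ι}
    {Z : ι → Finset (Fin n)} (hF : ∀ j ∈ F, HasPerfectTilingOn H G (Z j))
    (hd : (F : Set ι).PairwiseDisjoint Z) : HasPerfectTilingOn H G (F.biUnion Z) := by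
  induction F using Finset.induction_on with
  | empty => simpa using hasPerfectTilingOn_empty
  | insert j F hj ih =>
    rw [coe_insert, Set.pairwiseDisjoint_insert_of_notMem (by simpa using hj)] at hd
    rw [biUnion_insert]
    refine (hF j (mem_insert_self _ _)).union
      (ih (fun k hk => hF k (mem_insert_of_mem hk)) hd.1) ?_
    rw [disjoint_biUnion_right]
    exact fun k hk => hd.2 k hk

theorem HasPerfectTilingOn.dvd_card {A : Finset (Fin n)} (hA : HasPerfectTilingOn H G A) :
    h ∣ A.card := by
  obtain ⟨𝒜, hA1, hA2, rfl⟩ := hA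
  rw [card_biUnion hA2]
  exact dvd_sum fun T hT => by rw [id, (hA1 T hT).card]

/-- `S` can be exchanged between `X` and `Y`: it is disjoint from both, and both `S ∪ X` and
`S ∪ Y` have perfect `H`-tilings. -/
structure IsExchange (H : SimpleGraph (Fin h)) (G : SimpleGraph (Fin n))
    (X Y S : Finset (Fin n)) : Prop where
  disjoint_left : Disjoint S X
  disjoint_right : Disjoint S Y
  tiling_left : HasPerfectTilingOn H G (S ∪ X)
  tiling_right : HasPerfectTilingOn H G (S ∪ Y)

theorem IsExchange.trans {X Y Z S T : Finset (Fin n)} (hS : IsExchange H G X Y S)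
    (hT : IsExchange H G Y Z T) (hYX : Disjoint Y X) (hYZ : Disjoint Y Z) (hST : Disjoint S T)
    (hSZ : Disjoint S Z) (hTX : Disjoint T X) : IsExchange H G X Z (Y ∪ (S ∪ T)) where
  disjoint_left := by
    simp only [disjoint_union_left]; exact ⟨hYX, hS.1, hTX⟩
  disjoint_right := by
    simp only [disjoint_union_left]; exact ⟨hYZ, hSZ, hT.2⟩
  tiling_left := by
    have := hS.3.union hT.3 (by
      simp only [disjoint_union_left, disjoint_union_right]
      exact ⟨⟨hST, hTX.symm⟩, hS.2, hYX.symm⟩)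
    convert this using 1
    ext; simp only [mem_union]; tauto
  tiling_right := by
    have := hS.4.union hT.4 (by
      simp only [disjoint_union_left, disjoint_union_right]
      exact ⟨⟨hST, hT.1.symm⟩, hSZ, hYZ⟩)
    convert this using 1
    ext; simp only [mem_union]; tauto

theorem IsExchange.union {X Y X' Y' S T : Finset (Fin n)} (hS : IsExchange H G X Y S)
    (hT : IsExchange H G X' Y' T) (hX : Disjoint X X') (hY : Disjoint Y Y') (hST : Disjoint S T)
    (hSX' : Disjoint S X') (hSY' : Disjoint S Y') (hTX : Disjoint T X) (hTY : Disjoint T Y) :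
    IsExchange H G (X ∪ X') (Y ∪ Y') (S ∪ T) where
  disjoint_left := by
    simp only [disjoint_union_left, disjoint_union_right]; exact ⟨⟨hS.1, hTX⟩, hSX', hT.1⟩
  disjoint_right := by
    simp only [disjoint_union_left, disjoint_union_right]; exact ⟨⟨hS.2, hTY⟩, hSY', hT.2⟩
  tiling_left := by
    have := hS.3.union hT.3 (by
      simp only [disjoint_union_left, disjoint_union_right]
      exact ⟨⟨hST, hTX.symm⟩, hSX', hX⟩)
    convert this using 1
    ext; simp only [mem_union]; tauto
  tiling_right := by
    have := hS.4.union hT.4 (by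
      simp only [disjoint_union_left, disjoint_union_right]
      exact ⟨⟨hST, hTY.symm⟩, hSY', hY⟩)
    convert this using 1
    ext; simp only [mem_union]; tauto

end Tiles

section Neighbours

variable {h n : ℕ} {H : SimpleGraph (Fin h)} {G : SimpleGraph (Fin n)}

open Classical in
/-- The neighbours of `x`. -/
noncomputable def nbrs (G : SimpleGraph (Fin n)) (x : Fin n) : Finset (Fin n) :=
  {u | G.Adj x u}

open Classical in
/-- The neighbours of `x` lying to the right of `x`. -/
noncomputable def nbrsRight (G : SimpleGraph (Fin n)) (x : Fin n) : Finset (Fin n) :=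
  {u | x < u ∧ G.Adj x u}

open Classical in
/-- The neighbours of `x` lying to the left of `x`. -/
noncomputable def nbrsLeft (G : SimpleGraph (Fin n)) (x : Fin n) : Finset (Fin n) :=
  {u | u < x ∧ G.Adj x u}

@[simp] theorem mem_nbrs {x u : Fin n} : u ∈ nbrs G x ↔ G.Adj x u := by simp [nbrs]

@[simp] theorem mem_nbrsRight {x u : Fin n} : u ∈ nbrsRight G x ↔ x < u ∧ G.Adj x u := by
  simp [nbrsRight]

@[simp] theorem mem_nbrsLeft {x u : Fin n} : u ∈ nbrsLeft G x ↔ u < x ∧ G.Adj x u := by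
  simp [nbrsLeft]

theorem mem_nbrsLeft_comm {x u : Fin n} : u ∈ nbrsLeft G x ↔ x ∈ nbrsRight G u := by
  simp [G.adj_comm]

theorem odeg_eq_card_nbrs (x : Fin n) : odeg G x = (nbrs G x).card := by
  rw [odeg, ← Set.ncard_coe_finset]
  congr 1; ext; simp

theorem nbrs_eq_union (x : Fin n) : nbrs G x = nbrsLeft G x ∪ nbrsRight G x := by
  ext u
  simp only [mem_nbrs, mem_union, mem_nbrsLeft, mem_nbrsRight, ← or_and_right]
  exact ⟨fun h => ⟨lt_or_gt_of_ne h.ne', h⟩, And.right⟩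

theorem card_nbrs_le (x : Fin n) :
    (nbrs G x).card ≤ (nbrsLeft G x).card + (nbrsRight G x).card := by
  rw [nbrs_eq_union]; exact card_union_le _ _

/-- Two vertices with many common right-neighbours, each having many left-neighbours, can be
exchanged in robustly many ways. -/
theorem exchange_of_nbrsRight {i : ℕ} (hi : IsSplit H i) {x y : Fin n} {C : Finset (Fin n)}
    {c t : ℝ} (hc : 0 ≤ c) (hc1 : c ≤ 1) (hCx : C ⊆ nbrsRight G x) (hCy : C ⊆ nbrsRight G y)
    (hC : ∀ u ∈ C, 2 * c * n ≤ (nbrsLeft G u).card) (ht : t ≤ c * n - (h + 2))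
    (ht' : t ≤ c ^ h * C.card - (h + 2)) :
    RobustlyMany t (IsExchange H G {x} {y}) (h - 1) ∅ := by
  obtain ⟨h1, h2, -⟩ := id hi
  have hci : c ^ h ≤ c ^ (i - 1) := pow_le_pow_of_le_one hc hc1 (by omega)
  have hC0 : (0 : ℝ) ≤ C.card := Nat.cast_nonneg _
  have hcast : ((i - 1 : ℕ) : ℝ) + (h - i : ℕ) ≤ h := by
    exact_mod_cast (by omega : i - 1 + (h - i) ≤ h)
  have hcast' : (0 : ℝ) ≤ (h - i : ℕ) := Nat.cast_nonneg _
  have key := (RobustlyMany.bipartite C (nbrsLeft G) hc hc1 (by simpa using hC) (i - 1) (h - i)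
    (t := t + 2) (by simp only [Fintype.card_fin]; linarith) (by nlinarith)).avoid
    (disjoint_empty_left ({x, y} : Finset (Fin n)))
  rw [show i - 1 + (h - i) = h - 1 by omega] at key
  have hcard : (({x, y} : Finset (Fin n)).card : ℝ) ≤ 2 := by exact_mod_cast card_le_two
  refine key.mono (by linarith) ?_
  rintro S - ⟨⟨A, Q, hd, rfl, hA, hQ, hQC, hAQ⟩, hxy⟩
  simp only [disjoint_insert_right, disjoint_singleton_right, mem_union, not_or] at hxy
  obtain ⟨⟨hxA, hxQ⟩, hyA, hyQ⟩ := hxy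
  have tile : ∀ z, z ∉ A → C ⊆ nbrsRight G z → HasPerfectTilingOn H G (A ∪ Q ∪ {z}) := by
    intro z hzA hzC
    have : A ∪ Q ∪ {z} = insert z A ∪ Q := by ext; simp
    rw [this]
    refine (hi.isCopySet ?_ hQ ?_).hasPerfectTilingOn
    · rw [card_insert_of_notMem hzA, hA]; omega
    · intro u hu v hv
      rcases mem_insert.1 hu with rfl | hu
      · simpa using hzC (hQC hv)
      · have := hAQ v hv hu
        simp only [mem_nbrsLeft] at this
        exact ⟨this.1, this.2.symm⟩
  exact ⟨by simp [hxA, hxQ], by simp [hyA, hyQ], tile x hxA hCx, tile y hyA hCy⟩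

/-- Two vertices with many common left-neighbours, each having many right-neighbours, can be
exchanged in robustly many ways. -/
theorem exchange_of_nbrsLeft {i : ℕ} (hi : IsSplit H i) {x y : Fin n} {C : Finset (Fin n)}
    {c t : ℝ} (hc : 0 ≤ c) (hc1 : c ≤ 1) (hCx : C ⊆ nbrsLeft G x) (hCy : C ⊆ nbrsLeft G y)
    (hC : ∀ u ∈ C, 2 * c * n ≤ (nbrsRight G u).card) (ht : t ≤ c * n - (h + 2))
    (ht' : t ≤ c ^ h * C.card - (h + 2)) :
    RobustlyMany t (IsExchange H G {x} {y}) (h - 1) ∅ := by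
  obtain ⟨h1, h2, -⟩ := id hi
  have hci : c ^ h ≤ c ^ (h - i - 1) := pow_le_pow_of_le_one hc hc1 (by omega)
  have hC0 : (0 : ℝ) ≤ C.card := Nat.cast_nonneg _
  have hcast : ((h - i - 1 : ℕ) : ℝ) + (i : ℕ) ≤ h := by
    exact_mod_cast (by omega : h - i - 1 + i ≤ h)
  have hcast' : (0 : ℝ) ≤ (i : ℕ) := Nat.cast_nonneg _
  have key := (RobustlyMany.bipartite C (nbrsRight G) hc hc1 (by simpa using hC) (h - i - 1) i
    (t := t + 2) (by simp only [Fintype.card_fin]; linarith) (by nlinarith)).avoid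
    (disjoint_empty_left ({x, y} : Finset (Fin n)))
  rw [show h - i - 1 + i = h - 1 by omega] at key
  have hcard : (({x, y} : Finset (Fin n)).card : ℝ) ≤ 2 := by exact_mod_cast card_le_two
  refine key.mono (by linarith) ?_
  rintro S - ⟨⟨A, Q, hd, rfl, hA, hQ, hQC, hAQ⟩, hxy⟩
  simp only [disjoint_insert_right, disjoint_singleton_right, mem_union, not_or] at hxy
  obtain ⟨⟨hxA, hxQ⟩, hyA, hyQ⟩ := hxy
  have tile : ∀ z, z ∉ A → C ⊆ nbrsLeft G z → HasPerfectTilingOn H G (A ∪ Q ∪ {z}) := by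
    intro z hzA hzC
    have : A ∪ Q ∪ {z} = Q ∪ insert z A := by ext; simp; tauto
    rw [this]
    refine (hi.isCopySet hQ ?_ ?_).hasPerfectTilingOn
    · rw [card_insert_of_notMem hzA, hA]; omega
    · intro v hv u hu
      rcases mem_insert.1 hu with rfl | hu
      · have := hzC (hQC hv)
        simp only [mem_nbrsLeft] at this
        exact ⟨this.1, this.2.symm⟩
      · simpa using hAQ v hv hu
  exact ⟨by simp [hxA, hxQ], by simp [hyA, hyQ], tile x hxA hCx, tile y hyA hCy⟩

end Neighbours

section Reachability

variable {h n : ℕ} {H : SimpleGraph (Fin h)} {G : SimpleGraph (Fin n)}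

theorem IsExchange.symm {X Y S : Finset (Fin n)} (hS : IsExchange H G X Y S) :
    IsExchange H G Y X S :=
  ⟨hS.2, hS.1, hS.4, hS.3⟩

open Classical in
theorem card_many_light_le {N N' : Fin n → Finset (Fin n)} (hN : ∀ x u, u ∈ N x ↔ x ∈ N' u)
    {θ : ℝ} (hθ : 0 < θ) :
    (#{x | θ * n < (#{u ∈ N x | ((N' u).card : ℝ) < θ ^ 2 * n} : ℝ)} : ℝ) ≤ θ * n := by
  rcases Nat.eq_zero_or_pos n with rfl | hn
  · simp [Finset.univ_eq_empty]
  have hn' : (0 : ℝ) < n := by exact_mod_cast hn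
  set B : Finset (Fin n) := {x | θ * n < (#{u ∈ N x | ((N' u).card : ℝ) < θ ^ 2 * n} : ℝ)} with hB
  have h1 : ∑ x : Fin n, #{u ∈ N x | ((N' u).card : ℝ) < θ ^ 2 * n} =
      ∑ u : Fin n with ((N' u).card : ℝ) < θ ^ 2 * n, (N' u).card := by
    rw [sum_filter]
    simp_rw [card_eq_sum_ones, sum_filter]
    have : ∀ x, (∑ u ∈ N x, if ((∑ _y ∈ N' u, 1 : ℕ) : ℝ) < θ ^ 2 * n then 1 else 0) =
        ∑ u : Fin n, if x ∈ N' u then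
          (if ((∑ _y ∈ N' u, 1 : ℕ) : ℝ) < θ ^ 2 * n then 1 else 0) else 0 := by
      intro x
      refine Eq.trans (sum_congr ?_ fun _ _ => rfl) (sum_filter _ _)
      ext u; simp [hN]
    simp_rw [this]
    rw [sum_comm]
    refine sum_congr rfl fun u _ => ?_
    rw [← sum_filter, sum_const]
    split_ifs <;> simp
  have h2 : (∑ u : Fin n with ((N' u).card : ℝ) < θ ^ 2 * n, ((N' u).card : ℝ)) ≤
      n * (θ ^ 2 * n) := by
    calc _ ≤ ∑ u : Fin n with ((N' u).card : ℝ) < θ ^ 2 * n, θ ^ 2 * n :=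
          sum_le_sum fun u hu => (mem_filter.1 hu).2.le
      _ ≤ _ := by
        rw [sum_const, nsmul_eq_mul]
        gcongr
        simpa using card_le_univ (univ.filter fun u : Fin n => ((N' u).card : ℝ) < θ ^ 2 * n)
  have h3 : B.card * (θ * n) ≤
      ∑ x : Fin n, (#{u ∈ N x | ((N' u).card : ℝ) < θ ^ 2 * n} : ℝ) := by
    rw [← nsmul_eq_mul]
    refine (card_nsmul_le_sum B _ _ fun x hx => ?_).trans
      (sum_le_sum_of_subset_of_nonneg (subset_univ _) fun _ _ _ => Nat.cast_nonneg _)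
    exact (mem_filter.1 hx).2.le
  have h4 : ∑ x : Fin n, (#{u ∈ N x | ((N' u).card : ℝ) < θ ^ 2 * n} : ℝ) ≤ n * (θ ^ 2 * n) := by
    refine le_trans (le_of_eq ?_) h2
    exact_mod_cast h1
  have h5 : B.card * (θ * n) ≤ (θ * n) * (θ * n) := by linarith [sq_nonneg θ]
  exact le_of_mul_le_mul_right h5 (by positivity)

open Classical in
/-- `x` has few right-neighbours of small left-degree and few left-neighbours of small
right-degree. -/
def IsTypical (G : SimpleGraph (Fin n)) (θ : ℝ) (x : Fin n) : Prop :=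
  (#{u ∈ nbrsRight G x | ((nbrsLeft G u).card : ℝ) < θ ^ 2 * n} : ℝ) ≤ θ * n ∧
  (#{u ∈ nbrsLeft G x | ((nbrsRight G u).card : ℝ) < θ ^ 2 * n} : ℝ) ≤ θ * n

open Classical in
theorem card_not_isTypical_le {θ : ℝ} (hθ : 0 < θ) :
    (#{x | ¬ IsTypical G θ x} : ℝ) ≤ 2 * θ * n := by
  have h1 := card_many_light_le (N := nbrsRight G) (N' := nbrsLeft G)
    (fun x u => mem_nbrsLeft_comm.symm) hθ
  have h2 := card_many_light_le (N := nbrsLeft G) (N' := nbrsRight G)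
    (fun x u => mem_nbrsLeft_comm) hθ
  have h3 : (#{x | ¬ IsTypical G θ x}) ≤
      #{x | θ * n < (#{u ∈ nbrsRight G x | ((nbrsLeft G u).card : ℝ) < θ ^ 2 * n} : ℝ)} +
      #{x | θ * n < (#{u ∈ nbrsLeft G x | ((nbrsRight G u).card : ℝ) < θ ^ 2 * n} : ℝ)} := by
    refine le_trans (card_le_card fun x hx => ?_) (card_union_le _ _)
    simp only [mem_filter, mem_univ, true_and, mem_union, IsTypical, not_and_or, not_le] at hx ⊢
    exact hx
  have h3' : (#{x | ¬ IsTypical G θ x} : ℝ) ≤ _ := Nat.cast_le.2 h3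
  push_cast at h3'
  linarith

theorem two_mul_le_card_common {η : ℝ} (hdeg : ∀ x, (1 / 2 + η) * n ≤ ((nbrs G x).card : ℝ))
    (x y : Fin n) : 2 * η * n ≤ ((nbrs G x ∩ nbrs G y).card : ℝ) := by
  have h1 := card_union_add_card_inter (nbrs G x) (nbrs G y)
  have h2 : (nbrs G x ∪ nbrs G y).card ≤ n := by simpa using card_le_univ (nbrs G x ∪ nbrs G y)
  have h1' : ((nbrs G x ∪ nbrs G y).card : ℝ) + (nbrs G x ∩ nbrs G y).card =
    (nbrs G x).card + (nbrs G y).card := by exact_mod_cast h1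
  have h2' : ((nbrs G x ∪ nbrs G y).card : ℝ) ≤ n := by exact_mod_cast h2
  linarith [hdeg x, hdeg y]

/-- Typical vertices close to each other in the order are exchangeable in robustly many ways. -/
theorem exchange_of_close {i : ℕ} (hi : IsSplit H i) {η θ c t : ℝ}
    (hdeg : ∀ x, (1 / 2 + η) * n ≤ ((nbrs G x).card : ℝ)) (hθη : θ ≤ η / 4) (hc : 0 ≤ c)
    (hc1 : c ≤ 1) (hcθ : 2 * c ≤ θ ^ 2) (ht : t ≤ c * n - (h + 2))
    (ht' : t ≤ c ^ h * (η / 4 * n) - (h + 2)) {x y : Fin n}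
    (hx : IsTypical G θ x) (hy : IsTypical G θ y)
    (hxy : (x : ℝ) - y ≤ η * n) (hyx : (y : ℝ) - x ≤ η * n) :
    RobustlyMany t (IsExchange H G {x} {y}) (h - 1) ∅ := by
  classical
  wlog hle : x ≤ y generalizing x y
  · exact (this hy hx hyx hxy (le_of_not_ge hle)).mono le_rfl fun B _ hB => hB.symm
  have hn0 : (0 : ℝ) ≤ n := Nat.cast_nonneg n
  have hle' : (x : ℕ) ≤ y := hle
  have hcov : (nbrs G x ∩ nbrs G y).card ≤ (nbrsRight G x ∩ nbrsRight G y).card +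
      (nbrsLeft G x ∩ nbrsLeft G y).card + (Ioo x y).card := by
    refine le_trans (card_le_card fun u hu => ?_)
      ((card_union_le _ _).trans (Nat.add_le_add_right (card_union_le _ _) _))
    simp only [mem_inter, mem_nbrs, mem_union, mem_nbrsRight, mem_nbrsLeft, mem_Ioo] at hu ⊢
    have h1 := hu.1.ne
    have h2 := hu.2.ne
    rcases lt_or_gt_of_ne h1 with h3 | h3 <;> rcases lt_or_gt_of_ne h2 with h4 | h4
    · exact Or.inl (Or.inl ⟨⟨h3, hu.1⟩, h4, hu.2⟩)
    · exact Or.inr ⟨h3, h4⟩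
    · exact absurd (h4.trans (h3.trans_le hle)) (lt_irrefl _)
    · exact Or.inl (Or.inr ⟨⟨h3, hu.1⟩, h4, hu.2⟩)
  have hIoo : ((Ioo x y).card : ℝ) ≤ η * n := by
    refine le_trans ?_ hyx
    rw [Fin.card_Ioo, ← Nat.cast_sub hle']
    exact_mod_cast Nat.sub_le _ _
  have hcom := two_mul_le_card_common hdeg x y
  have hcov' : ((nbrs G x ∩ nbrs G y).card : ℝ) ≤ (nbrsRight G x ∩ nbrsRight G y).card +
      (nbrsLeft G x ∩ nbrsLeft G y).card + (Ioo x y).card := by exact_mod_cast hcov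
  have hch : 0 ≤ c ^ h := pow_nonneg hc h
  rcases le_total ((nbrsLeft G x ∩ nbrsLeft G y).card : ℝ)
    ((nbrsRight G x ∩ nbrsRight G y).card : ℝ) with hcase | hcase
  · set Bad : Finset (Fin n) := {u ∈ nbrsRight G x | ((nbrsLeft G u).card : ℝ) < θ ^ 2 * n}
    have hsub : ((nbrsRight G x ∩ nbrsRight G y).card : ℝ) ≤
        ((nbrsRight G x ∩ nbrsRight G y) \ Bad).card + Bad.card := by
      exact_mod_cast card_le_card_sdiff_add_card
    refine exchange_of_nbrsRight hi hc hc1 (C := (nbrsRight G x ∩ nbrsRight G y) \ Bad)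
      (sdiff_subset.trans inter_subset_left) (sdiff_subset.trans inter_subset_right)
      (fun u hu => ?_) ht (ht'.trans ?_)
    · simp only [Bad, mem_sdiff, mem_inter, mem_filter, not_and, not_lt] at hu
      exact le_trans (by gcongr) (hu.2 hu.1.1)
    · have : η / 4 * n ≤ (((nbrsRight G x ∩ nbrsRight G y) \ Bad).card : ℝ) := by
        have := hx.1
        nlinarith
      gcongr
  · set Bad : Finset (Fin n) := {u ∈ nbrsLeft G x | ((nbrsRight G u).card : ℝ) < θ ^ 2 * n}
    have hsub : ((nbrsLeft G x ∩ nbrsLeft G y).card : ℝ) ≤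
        ((nbrsLeft G x ∩ nbrsLeft G y) \ Bad).card + Bad.card := by
      exact_mod_cast card_le_card_sdiff_add_card
    refine exchange_of_nbrsLeft hi hc hc1 (C := (nbrsLeft G x ∩ nbrsLeft G y) \ Bad)
      (sdiff_subset.trans inter_subset_left) (sdiff_subset.trans inter_subset_right)
      (fun u hu => ?_) ht (ht'.trans ?_)
    · simp only [Bad, mem_sdiff, mem_inter, mem_filter, not_and, not_lt] at hu
      exact le_trans (by gcongr) (hu.2 hu.1.1)
    · have : η / 4 * n ≤ (((nbrsLeft G x ∩ nbrsLeft G y) \ Bad).card : ℝ) := by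
        have := hx.2
        nlinarith
      gcongr

theorem card_nbrsLeft_ge {η : ℝ} (hdeg : ∀ x, (1 / 2 + η) * n ≤ ((nbrs G x).card : ℝ))
    {u : Fin n} (hu : n ≤ 2 * (u : ℕ)) : η * n ≤ ((nbrsLeft G u).card : ℝ) := by
  have h1 : (nbrsRight G u).card ≤ n - 1 - u := by
    rw [← Fin.card_Ioi]
    exact card_le_card fun v hv => mem_Ioi.2 (mem_nbrsRight.1 hv).1
  have h2 : 2 * ((nbrs G u).card : ℝ) ≤ 2 * (nbrsLeft G u).card + n := by
    have := card_nbrs_le (G := G) u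
    exact_mod_cast (by omega : 2 * (nbrs G u).card ≤ 2 * (nbrsLeft G u).card + n)
  linarith [hdeg u]

theorem card_nbrsRight_ge {η : ℝ} (hdeg : ∀ x, (1 / 2 + η) * n ≤ ((nbrs G x).card : ℝ))
    {u : Fin n} (hu : 2 * (u : ℕ) < n) : η * n ≤ ((nbrsRight G u).card : ℝ) := by
  have h1 : (nbrsLeft G u).card ≤ u := by
    rw [← Fin.card_Iio]
    exact card_le_card fun v hv => mem_Iio.2 (mem_nbrsLeft.1 hv).1
  have h2 : 2 * ((nbrs G u).card : ℝ) ≤ 2 * (nbrsRight G u).card + n := by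
    have := card_nbrs_le (G := G) u
    exact_mod_cast (by omega : 2 * (nbrs G u).card ≤ 2 * (nbrsRight G u).card + n)
  linarith [hdeg u]

theorem two_mul_card_lower_half_le : 2 * #{u : Fin n | 2 * (u : ℕ) < n} ≤ n + 1 := by
  have : #{u : Fin n | 2 * (u : ℕ) < n} ≤ (range ((n + 1) / 2)).card := by
    refine card_le_card_of_injOn (fun u => (u : ℕ)) (fun u hu => ?_) Fin.val_injective.injOn
    simp only [coe_filter, mem_univ, true_and, Set.mem_ofPred_eq] at hu
    simp only [coe_range, Set.mem_Iio]
    omega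
  rw [card_range] at this
  omega

theorem two_mul_card_upper_half_le : 2 * #{u : Fin n | n ≤ 2 * (u : ℕ)} ≤ n := by
  have h1 : #{u : Fin n | n ≤ 2 * (u : ℕ)} ≤ (Ico ((n + 1) / 2) n).card := by
    refine card_le_card_of_injOn (fun u => (u : ℕ)) (fun u hu => ?_) Fin.val_injective.injOn
    simp only [coe_filter, mem_univ, true_and, Set.mem_ofPred_eq] at hu
    simp only [coe_Ico, Set.mem_Ico]
    have := u.2
    omega
  rw [Nat.card_Ico] at h1
  omega

open Classical in
/-- Every vertex is exchangeable in robustly many ways with linearly many typical vertices. -/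
theorem exists_typical_exchange {i : ℕ} (hi : IsSplit H i) {η θ c t : ℝ} (hη : 0 < η)
    (hη1 : η ≤ 1) (hn : 1 ≤ η * n)
    (hdeg : ∀ x, (1 / 2 + η) * n ≤ ((nbrs G x).card : ℝ)) (hθ : 0 < θ) (hθη : θ ≤ η / 8)
    (hc : 0 ≤ c) (hc1 : 2 * c ≤ η) (ht : t ≤ c * n - (h + 2))
    (ht' : t ≤ c ^ h * (η ^ 2 / 4 * n) - (h + 2)) (x : Fin n) :
    ∃ D : Finset (Fin n), η / 4 * n ≤ D.card ∧
      ∀ y ∈ D, IsTypical G θ y ∧ RobustlyMany t (IsExchange H G {x} {y}) (h - 1) ∅ := by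
  have hn0 : (0 : ℝ) ≤ n := Nat.cast_nonneg n
  have hch : 0 ≤ c ^ h := pow_nonneg hc h
  have htyp := card_not_isTypical_le (G := G) hθ
  have main : ∀ (C : Finset (Fin n)) (N : Fin n → Finset (Fin n)), η / 2 * n ≤ C.card →
      (∀ u ∈ C, η * n ≤ (N u).card) →
      ∃ D : Finset (Fin n), η / 4 * n ≤ D.card ∧
        ∀ y ∈ D, IsTypical G θ y ∧ η ^ 2 / 4 * n ≤ (#{u ∈ C | y ∈ N u} : ℝ) := by
    intro C N hC hN
    have h1 := card_heavy_ge C N (c := η / 2) (by positivity) (by linarith)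
      (by simpa using fun u hu => by linarith [hN u hu])
    rw [Fintype.card_fin] at h1
    set F : Finset (Fin n) := {y | η / 2 * C.card ≤ (#{u ∈ C | y ∈ N u} : ℝ)} with hF
    set B : Finset (Fin n) := {y | ¬ IsTypical G θ y} with hB
    refine ⟨F \ B, ?_, fun y hy => ?_⟩
    · have : (F.card : ℝ) ≤ (F \ B).card + B.card := by
        exact_mod_cast card_le_card_sdiff_add_card
      nlinarith
    · simp only [hF, hB, mem_sdiff, mem_filter, mem_univ, true_and, not_not] at hy
      refine ⟨hy.2, le_trans ?_ hy.1⟩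
      calc η ^ 2 / 4 * n = η / 2 * (η / 2 * n) := by ring
        _ ≤ _ := by gcongr
  rcases lt_or_ge (2 * (x : ℕ)) n with hx | hx
  · obtain ⟨D, hD, hD'⟩ := main {u ∈ nbrs G x | n ≤ 2 * (u : ℕ)} (nbrsLeft G) (by
      have h1 := card_filter_add_card_filter_not (s := nbrs G x)
        (fun u : Fin n => n ≤ 2 * (u : ℕ))
      have h2 : #((nbrs G x).filter fun u : Fin n => ¬ n ≤ 2 * (u : ℕ)) ≤ #{u : Fin n | 2 * (u : ℕ) < n} := by
        refine card_le_card fun u hu => ?_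
        simp only [mem_filter, mem_univ, true_and, not_le] at hu ⊢
        exact hu.2
      have h3 := two_mul_card_lower_half_le (n := n)
      have h4 : 2 * ((nbrs G x).card : ℝ) ≤ 2 * #((nbrs G x).filter fun u : Fin n => n ≤ 2 * (u : ℕ)) + (n + 1) := by
        exact_mod_cast (by omega)
      linarith [hdeg x]) fun u hu => card_nbrsLeft_ge hdeg (mem_filter.1 hu).2
    refine ⟨D, hD, fun y hy => ⟨(hD' y hy).1, ?_⟩⟩
    refine exchange_of_nbrsRight hi hc (by linarith) (fun u hu => ?_) (fun u hu => ?_)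
      (fun u hu => ?_) ht (ht'.trans (sub_le_sub_right
        (mul_le_mul_of_nonneg_left (hD' y hy).2 hch) _))
    · simp only [mem_filter, mem_nbrs] at hu
      exact mem_nbrsRight.2 ⟨Fin.lt_def.2 (by omega), hu.1.1⟩
    · exact mem_nbrsLeft_comm.1 (mem_filter.1 hu).2
    · exact le_trans (by gcongr) (card_nbrsLeft_ge hdeg (mem_filter.1 (mem_filter.1 hu).1).2)
  · obtain ⟨D, hD, hD'⟩ := main {u ∈ nbrs G x | 2 * (u : ℕ) < n} (nbrsRight G) (by
      have h1 := card_filter_add_card_filter_not (s := nbrs G x)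
        (fun u : Fin n => 2 * (u : ℕ) < n)
      have h2 : #((nbrs G x).filter fun u : Fin n => ¬ 2 * (u : ℕ) < n) ≤ #{u : Fin n | n ≤ 2 * (u : ℕ)} := by
        refine card_le_card fun u hu => ?_
        simp only [mem_filter, mem_univ, true_and, not_lt] at hu ⊢
        exact hu.2
      have h3 := two_mul_card_upper_half_le (n := n)
      have h4 : 2 * ((nbrs G x).card : ℝ) ≤ 2 * #((nbrs G x).filter fun u : Fin n => 2 * (u : ℕ) < n) + n := by
        exact_mod_cast (by omega)
      linarith [hdeg x]) fun u hu => card_nbrsRight_ge hdeg (mem_filter.1 hu).2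
    refine ⟨D, hD, fun y hy => ⟨(hD' y hy).1, ?_⟩⟩
    refine exchange_of_nbrsLeft hi hc (by linarith) (fun u hu => ?_) (fun u hu => ?_)
      (fun u hu => ?_) ht (ht'.trans (sub_le_sub_right
        (mul_le_mul_of_nonneg_left (hD' y hy).2 hch) _))
    · simp only [mem_filter, mem_nbrs] at hu
      exact mem_nbrsLeft.2 ⟨Fin.lt_def.2 (by omega), hu.1.1⟩
    · exact mem_nbrsLeft_comm.2 (mem_filter.1 hu).2
    · exact le_trans (by gcongr) (card_nbrsRight_ge hdeg (mem_filter.1 (mem_filter.1 hu).1).2)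

theorem exchange_trans {D : Finset (Fin n)} {x y : Fin n} {t : ℝ} {s₁ s₂ : ℕ} (hD : t ≤ D.card)
    (h₁ : ∀ z ∈ D, RobustlyMany t (IsExchange H G {x} {z}) s₁ ∅)
    (h₂ : ∀ z ∈ D, RobustlyMany t (IsExchange H G {z} {y}) s₂ ∅) :
    RobustlyMany (t - (s₁ + 3)) (IsExchange H G {x} {y}) (1 + (s₁ + s₂)) ∅ := by
  classical
  have hs₁ : (0 : ℝ) ≤ s₁ := Nat.cast_nonneg _
  have hfirst : RobustlyMany (t - 2) (fun B => ∃ z, B = {z} ∧ z ∈ D ∧ z ≠ x ∧ z ≠ y) 1 ∅ := by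
    refine RobustlyMany.single ?_
    have h1 : D.card ≤ #{z | z ∈ D ∧ z ≠ x ∧ z ≠ y} + 2 := by
      have : D ⊆ ({z | z ∈ D ∧ z ≠ x ∧ z ≠ y} : Finset (Fin n)) ∪ {x, y} := by
        intro z hz
        by_cases hzx : z = x
        · simp [hzx]
        by_cases hzy : z = y
        · simp [hzy]
        simp [hz, hzx, hzy]
      exact (card_le_card this).trans ((card_union_le _ _).trans
        (Nat.add_le_add_left card_le_two _))
    have h1' : (D.card : ℝ) ≤ #{z | z ∈ D ∧ z ≠ x ∧ z ≠ y} + 2 := by exact_mod_cast h1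
    have h2 : t - 2 ≤ #{z | z ∈ D ∧ z ≠ x ∧ z ≠ y} := by linarith
    convert h2
  refine (hfirst.bind (t := t - (s₁ + 3)) (t₂ := t - 1 - s₁) (by linarith)
    (by push_cast; linarith)
    (Q := fun Z B => ∀ z, Z = {z} → IsExchange H G {x} {y} ({z} ∪ B)) ?_).mono le_rfl ?_
  · rintro _ - ⟨z, rfl, hz, hzx, hzy⟩
    refine (((h₁ z hz).avoid (disjoint_empty_left {y})).bind (t := t - 1 - s₁)
      (t₂ := t - 1) (Q := fun _ B => IsExchange H G {z} {y} B ∧ Disjoint B {x})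
      (by simp only [card_singleton]; push_cast; linarith)
      le_rfl fun S _ _ => ?_).mono le_rfl ?_
    · simpa using (h₂ z hz).avoid (disjoint_empty_left {x})
    · rintro B - ⟨S, T, hST, rfl, ⟨hS, hSy⟩, hT, hTx⟩ z' hz'
      obtain rfl : z = z' := singleton_injective hz'
      exact hS.trans hT (by simpa using hzx) (by simpa using hzy) hST hSy hTx
  · rintro B - ⟨Z, S, -, rfl, ⟨z, rfl, -⟩, h⟩
    exact h z rfl

open Classical in
/-- If the vertices are divided into `K` blocks, each with many vertices satisfying `p`, and any
two such vertices from the same or consecutive blocks are robustly exchangeable, then so are any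
two vertices satisfying `p`. -/
theorem exchange_chain (hh : 0 < h) {p : Fin n → Prop} {blk : Fin n → ℕ} {K : ℕ} {t : ℝ}
    (hblk : ∀ x, blk x < K) (hp : ∀ b < K, t ≤ (#{z | p z ∧ blk z = b} : ℝ))
    (hclose : ∀ x y, p x → p y → blk x ≤ blk y + 1 → blk y ≤ blk x + 1 →
      RobustlyMany t (IsExchange H G {x} {y}) (h - 1) ∅) (k : ℕ) (hk : k ≤ K) (x y : Fin n)
    (hx : p x) (hy : p y) (hxy : blk x ≤ blk y + (k + 1)) (hyx : blk y ≤ blk x + (k + 1)) :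
    RobustlyMany (t - k * (K * h + h + 3)) (IsExchange H G {x} {y})
      (k * (h - 1 + 1) + (h - 1)) ∅ := by
  induction k generalizing y with
  | zero =>
    simpa using hclose x y hx hy (by omega) (by omega)
  | succ k ih =>
    have hle : ((k * (h - 1 + 1) + (h - 1) : ℕ) : ℝ) ≤ K * h + h := by
      have h1 : k * (h - 1 + 1) + (h - 1) ≤ K * h + h := by
        have := Nat.mul_le_mul_right h (by omega : k ≤ K)
        rw [Nat.sub_add_cancel hh]
        omega
      exact_mod_cast h1
    obtain ⟨b, hb, hb1, hb2, hb3, hb4⟩ : ∃ b < K, blk x ≤ b + (k + 1) ∧ b ≤ blk x + (k + 1) ∧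
        b ≤ blk y + 1 ∧ blk y ≤ b + 1 := by
      have hbx := hblk x
      have hby := hblk y
      rcases lt_trichotomy (blk x) (blk y) with hlt | heq | hgt
      · exact ⟨blk y - 1, by omega, by omega, by omega, by omega, by omega⟩
      · exact ⟨blk y, by omega, by omega, by omega, by omega, by omega⟩
      · exact ⟨blk y + 1, by omega, by omega, by omega, by omega, by omega⟩
    have hpos : (0 : ℝ) ≤ k * (K * h + h + 3) := by positivity
    have key := exchange_trans (H := H) (G := G) (x := x) (y := y) (t := t - k * (K * h + h + 3))
      (D := {z | p z ∧ blk z = b})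
      (s₁ := k * (h - 1 + 1) + (h - 1)) (s₂ := h - 1) (by linarith [hp b hb]) (fun z hz => ?_)
      (fun z hz => ?_)
    · rw [show (k + 1) * (h - 1 + 1) + (h - 1) = 1 + (k * (h - 1 + 1) + (h - 1) + (h - 1)) by ring]
      refine key.mono ?_ fun _ _ h => h
      push_cast at hle ⊢
      nlinarith
    · simp only [mem_filter, mem_univ, true_and] at hz
      exact ih (by omega) z hz.1 (by omega) (by omega)
    · simp only [mem_filter, mem_univ, true_and] at hz
      exact (hclose z y hz.1 hy (by omega) (by omega)).mono (by linarith) fun _ _ h => h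

end Reachability

section Blocks

variable {n K : ℕ}

/-- The index of the block containing `x` when `Fin n` is cut into `K` intervals of almost
equal length. -/
def blockIndex (K : ℕ) (x : Fin n) : ℕ := min (x / (n / K)) (K - 1)

theorem blockIndex_lt (hK : 0 < K) (x : Fin n) : blockIndex K x < K :=
  (min_le_right _ _).trans_lt (by omega)

theorem le_of_blockIndex_le (hK : 0 < K) (hKn : K ≤ n) {x y : Fin n}
    (hxy : blockIndex K x ≤ blockIndex K y + 1) : (x : ℕ) ≤ y + 2 * (n / K) + K := by
  have hw : 0 < n / K := Nat.div_pos hKn hK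
  have h1 : blockIndex K y * (n / K) ≤ y :=
    (Nat.mul_le_mul_right _ (min_le_left _ _)).trans (Nat.div_mul_le_self _ _)
  have h2 : (x : ℕ) ≤ (blockIndex K x + 1) * (n / K) + K := by
    rcases min_choice ((x : ℕ) / (n / K)) (K - 1) with h | h
    · rw [blockIndex, h]
      have := Nat.lt_div_mul_add (a := (x : ℕ)) hw
      rw [add_one_mul]; omega
    · rw [blockIndex, h, Nat.sub_add_cancel hK]
      have := Nat.div_add_mod n K
      have := Nat.mod_lt n hK
      have := x.2
      omega
  have h3 := Nat.mul_le_mul_right (n / K) hxy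
  rw [add_one_mul] at h2 h3
  omega

theorem card_blockIndex_eq_ge (hK : 0 < K) (hKn : K ≤ n) {b : ℕ} (hb : b < K) :
    n / K ≤ #{z : Fin n | blockIndex K z = b} := by
  have hw : 0 < n / K := Nat.div_pos hKn hK
  have hbn : b * (n / K) + n / K ≤ n := by
    rw [← add_one_mul]
    exact (Nat.mul_le_mul_right _ hb).trans (Nat.mul_div_le n K)
  let f : Fin (n / K) → Fin n := fun j => ⟨b * (n / K) + j, by omega⟩
  have hf : Function.Injective f := fun i j hij => by
    simp only [f, Fin.mk.injEq] at hij
    exact Fin.ext (by omega)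
  calc n / K = (univ.image f).card := by
        rw [card_image_of_injective _ hf, card_univ, Fintype.card_fin]
    _ ≤ _ := by
      refine card_le_card fun z hz => ?_
      obtain ⟨j, -, rfl⟩ := mem_image.1 hz
      rw [mem_filter]
      refine ⟨mem_univ _, ?_⟩
      simp only [blockIndex, f]
      rw [Nat.mul_comm b, Nat.mul_add_div hw, Nat.div_eq_of_lt j.2]
      omega

end Blocks

section Absorbers

variable {h : ℕ} {H : SimpleGraph (Fin h)}

open Classical in
theorem card_typical_block_ge {n K : ℕ} {G : SimpleGraph (Fin n)} {θ : ℝ} (hK : 0 < K)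
    (hKn : 4 * K ≤ n) (hθ : 0 < θ) (hθK : θ * K = 1 / 8) {b : ℕ} (hb : b < K) :
    2 * θ * n ≤ (#{z : Fin n | IsTypical G θ z ∧ blockIndex K z = b} : ℝ) := by
  have hK' : (0 : ℝ) < K := by exact_mod_cast hK
  have hKn' : (4 : ℝ) * K ≤ n := by exact_mod_cast hKn
  have hwn : (n : ℝ) ≤ (n / K : ℕ) * K + K := by
    have h1 := Nat.div_add_mod n K
    have h2 := Nat.mod_lt n hK
    rw [mul_comm] at h1
    exact_mod_cast (by omega : n ≤ n / K * K + K)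
  have h1 := card_blockIndex_eq_ge (n := n) hK (by omega) hb
  have h2 : #{z : Fin n | blockIndex K z = b} ≤
      #{z : Fin n | IsTypical G θ z ∧ blockIndex K z = b} + #{z | ¬ IsTypical G θ z} := by
    refine (card_le_card fun z hz => ?_).trans (card_union_le _ _)
    simp only [mem_filter, mem_univ, true_and, mem_union] at hz ⊢
    tauto
  have h3 : ((n / K : ℕ) : ℝ) ≤ #{z : Fin n | IsTypical G θ z ∧ blockIndex K z = b} +
      #{z | ¬ IsTypical G θ z} := by exact_mod_cast h1.trans h2
  have h4 := card_not_isTypical_le (G := G) hθ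
  have h5 : (4 * θ * n) * K ≤ (n / K : ℕ) * K := by
    have : (4 * θ * n) * K = n / 2 := by linear_combination (4 * n) * hθK
    linarith
  linarith [le_of_mul_le_mul_right h5 hK']

theorem sub_le_of_blockIndex_le {n K : ℕ} {η : ℝ} (hK : 0 < K) (hKn : K ≤ n) (hKη : 4 ≤ K * η)
    (hKn' : 2 * K ≤ η * n) {x y : Fin n} (hxy : blockIndex K x ≤ blockIndex K y + 1) :
    ((x : ℕ) : ℝ) - (y : ℕ) ≤ η * n := by
  have hK' : (0 : ℝ) < K := by exact_mod_cast hK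
  have hη : 0 ≤ η := by by_contra hcon; nlinarith
  have hwn : ((n / K : ℕ) : ℝ) * K ≤ n := by exact_mod_cast Nat.div_mul_le_self n K
  have h1 : ((x : ℕ) : ℝ) ≤ (y : ℕ) + 2 * (n / K : ℕ) + K := by
    exact_mod_cast le_of_blockIndex_le hK hKn hxy
  have h2 : ((n / K : ℕ) : ℝ) * 4 ≤ (n / K : ℕ) * (K * η) := by gcongr
  have h3 : ((n / K : ℕ) : ℝ) * K * η ≤ n * η := by gcongr
  linarith

theorem exchange_of_isTypical {n i K : ℕ} (hi : IsSplit H i) {G : SimpleGraph (Fin n)}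
    {η θ c t : ℝ} (hdeg : ∀ x, (1 / 2 + η) * n ≤ ((nbrs G x).card : ℝ)) (hK : 0 < K)
    (hKn : 4 * K ≤ n) (hKη : 4 ≤ K * η) (hKn' : 2 * K ≤ η * n) (hθ : 0 < θ)
    (hθK : θ * K = 1 / 8) (hθη : θ ≤ η / 4) (hc : 0 ≤ c) (hc1 : c ≤ 1) (hcθ : 2 * c ≤ θ ^ 2)
    (ht : t ≤ c * n - (h + 2)) (ht' : t ≤ c ^ h * (η / 4 * n) - (h + 2)) (htθ : t ≤ 2 * θ * n)
    {x y : Fin n} (hx : IsTypical G θ x) (hy : IsTypical G θ y) :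
    RobustlyMany (t - K * (K * h + h + 3)) (IsExchange H G {x} {y})
      (K * (h - 1 + 1) + (h - 1)) ∅ := by
  have h1 := blockIndex_lt hK x
  have h2 := blockIndex_lt hK y
  refine exchange_chain (by have := hi.2.1; omega) (blockIndex_lt hK)
    (fun b hb => htθ.trans (card_typical_block_ge hK hKn hθ hθK hb))
    (fun x y hx hy hxy hyx => ?_) K le_rfl x y hx hy (by omega) (by omega)
  exact exchange_of_close hi hdeg hθη hc hc1 hcθ ht ht' hx hy
    (sub_le_of_blockIndex_le hK (by omega) hKη hKn' hxy)
    (sub_le_of_blockIndex_le hK (by omega) hKη hKn' hyx)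

/-- If every vertex is exchangeable with linearly many vertices satisfying `p`, and any two
vertices satisfying `p` are exchangeable, then any two vertices are exchangeable. -/
theorem exchange_of_reach {n : ℕ} {G : SimpleGraph (Fin n)} {p : Fin n → Prop} {t t₁ : ℝ}
    {s s₁ : ℕ} (htt : t₁ ≤ t) (hreach : ∀ x, ∃ D : Finset (Fin n), t ≤ D.card ∧
      ∀ y ∈ D, p y ∧ RobustlyMany t (IsExchange H G {x} {y}) s ∅)
    (hp : ∀ x y, p x → p y → RobustlyMany t₁ (IsExchange H G {x} {y}) s₁ ∅) (x y : Fin n) :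
    RobustlyMany (t₁ - (s + 3) - ((1 + (s + s₁) : ℕ) + 3)) (IsExchange H G {x} {y})
      (1 + (1 + (s + s₁) + s)) ∅ := by
  have hs : (0 : ℝ) ≤ s := Nat.cast_nonneg s
  obtain ⟨D, hD, hyD⟩ := hreach y
  refine exchange_trans (D := D) (by linarith) (fun z hz => ?_)
    (fun z hz => (hyD z hz).2.mono (by linarith) fun _ _ h => h.symm)
  obtain ⟨E, hE, hxE⟩ := hreach x
  exact exchange_trans (htt.trans hE) (fun w hw => (hxE w hw).2.mono htt fun _ _ h => h)
    (fun w hw => hp w z (hxE w hw).1 (hyD z hz).1)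

/-- Any two vertices of a graph of large minimum degree are robustly exchangeable. -/
theorem exists_exchange {i : ℕ} (hi : IsSplit H i) {η : ℝ} (hη : 0 < η) (hη1 : η ≤ 1) :
    ∃ τ : ℝ, 0 < τ ∧ ∃ s n₀ : ℕ, ∀ n, n₀ ≤ n → ∀ G : SimpleGraph (Fin n),
      (∀ x, (1 / 2 + η) * n ≤ ((nbrs G x).card : ℝ)) → ∀ x y,
      RobustlyMany (τ * n) (IsExchange H G {x} {y}) s ∅ := by
  obtain ⟨K, hK⟩ := exists_nat_ge (4 / η)
  have hKη : 4 ≤ K * η := by rwa [div_le_iff₀ hη] at hK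
  have hK0' : (0 : ℝ) < K := by by_contra hcon; nlinarith
  have hK0 : 0 < K := by exact_mod_cast hK0'
  obtain ⟨θ, hθ0, hθK⟩ : ∃ θ : ℝ, 0 < θ ∧ θ * K = 1 / 8 :=
    ⟨1 / (8 * K), by positivity, by field_simp⟩
  have hθη : θ ≤ η / 8 := by nlinarith
  obtain ⟨c, hc0, hc⟩ : ∃ c : ℝ, 0 < c ∧ 2 * c = θ ^ 2 := ⟨θ ^ 2 / 2, by positivity, by ring⟩
  have hcθ : 2 * c ≤ θ := by nlinarith
  obtain ⟨β, hβ0, hβ1, hβ2⟩ : ∃ β, 0 < β ∧ 2 * β ≤ c ∧ 2 * β ≤ c ^ h * (η ^ 2 / 4) := by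
    refine ⟨min c (c ^ h * (η ^ 2 / 4)) / 2, by positivity, ?_, ?_⟩
    · linarith [min_le_left c (c ^ h * (η ^ 2 / 4))]
    · linarith [min_le_right c (c ^ h * (η ^ 2 / 4))]
  set s₁ : ℕ := K * (h - 1 + 1) + (h - 1)
  set C : ℝ := K * (K * h + h + 3) + ((h - 1 : ℕ) + 3) + ((1 + (h - 1 + s₁) : ℕ) + 3) with hC
  obtain ⟨n₀, hn₀⟩ := exists_nat_ge (max (2 * C / β) (max ((h + 2) / β) (max (4 * K) (2 * K / η))))
  refine ⟨β / 2, by positivity, 1 + (1 + (h - 1 + s₁) + (h - 1)), n₀, fun n hn G hdeg x y => ?_⟩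
  have hn' : max (2 * C / β) (max ((h + 2) / β) (max (4 * K) (2 * K / η))) ≤ (n : ℝ) :=
    hn₀.trans (by exact_mod_cast hn)
  simp only [max_le_iff] at hn'
  obtain ⟨hn1, hn2, hn3, hn4⟩ := hn'
  rw [div_le_iff₀ hβ0] at hn1 hn2
  rw [div_le_iff₀ hη] at hn4
  have hn0 : (0 : ℝ) ≤ n := Nat.cast_nonneg n
  have hKn : 4 * K ≤ n := by exact_mod_cast hn3
  have hβc : 2 * β * n ≤ c * n := by gcongr
  have ht1 : β * n ≤ c * n - (h + 2) := by linarith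
  have ht2 : β * n ≤ c ^ h * (η ^ 2 / 4 * n) - (h + 2) := by
    have : 2 * β * n ≤ c ^ h * (η ^ 2 / 4) * n := by gcongr
    linarith
  have ht3 : β * n ≤ c ^ h * (η / 4 * n) - (h + 2) := by
    refine ht2.trans (sub_le_sub_right (mul_le_mul_of_nonneg_left ?_ (by positivity)) _)
    gcongr
    nlinarith
  have hcn : 2 * c * n ≤ θ * n := by gcongr
  have hθn : θ * n ≤ η / 8 * n := by gcongr
  have hKh : (0 : ℝ) ≤ K * (K * h + h + 3) := by positivity
  refine (exchange_of_reach (t := β * n) (t₁ := β * n - K * (K * h + h + 3)) (p := IsTypical G θ)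
    (by linarith) (fun x => ?_) (fun x y hx hy => ?_) x y).mono (by linarith) fun _ _ h => h
  · obtain ⟨D, hD, hD'⟩ := exists_typical_exchange hi hη hη1 (by linarith) hdeg hθ0 hθη hc0.le
      (by linarith) ht1 ht2 x
    exact ⟨D, by linarith, hD'⟩
  · exact exchange_of_isTypical hi hdeg hK0 hKn hKη (by linarith) hθ0 hθK (by linarith) hc0.le
      (by linarith) hc.le ht1 ht3 (by linarith) hx hy

/-- If vertices are robustly exchangeable, then so are vertex sets of equal size. -/
theorem exchange_sets {n : ℕ} {G : SimpleGraph (Fin n)} {t : ℝ} {s : ℕ}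
    (hex : ∀ x y, RobustlyMany t (IsExchange H G {x} {y}) s ∅) (k : ℕ) {X Y : Finset (Fin n)}
    (hX : X.card = k) (hY : Y.card = k) :
    RobustlyMany (t - k * (s + 2)) (IsExchange H G X Y) (k * s) ∅ := by
  induction k generalizing X Y with
  | zero =>
    rw [card_eq_zero] at hX hY
    subst hX hY
    rw [zero_mul]
    refine ⟨disjoint_empty_left _, disjoint_empty_left _, ?_, ?_⟩ <;>
      simpa using hasPerfectTilingOn_empty
  | succ k ih =>
    obtain ⟨x, X, hx, rfl, rfl⟩ := card_eq_succ.1 hX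
    obtain ⟨y, Y, hy, rfl, hY'⟩ := card_eq_succ.1 hY
    set k := X.card
    have h1 := (ih rfl hY').avoid (disjoint_empty_left {x, y})
    have h2 := (hex x y).avoid (disjoint_empty_left (X ∪ Y))
    have hc1 : (({x, y} : Finset (Fin n)).card : ℝ) ≤ 2 := by exact_mod_cast card_le_two
    have hc2 : ((X ∪ Y).card : ℝ) ≤ 2 * k := by
      exact_mod_cast (card_union_le _ _).trans (by omega)
    have hs : (0 : ℝ) ≤ s := Nat.cast_nonneg s
    have hk : (0 : ℝ) ≤ k := Nat.cast_nonneg k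
    rw [show (k + 1) * s = k * s + s by ring]
    refine (h1.bind (t := t - (k + 1 : ℕ) * (s + 2)) (t₂ := t - (X ∪ Y).card) (by push_cast; linarith)
      (by push_cast; linarith) (Q := fun _ B => IsExchange H G {x} {y} B ∧ Disjoint B (X ∪ Y))
      fun _ _ _ => h2).mono le_rfl ?_
    rintro B - ⟨S, T, hST, rfl, ⟨hS, hS'⟩, hT, hT'⟩
    rw [disjoint_union_right] at hT'
    rw [disjoint_insert_right, disjoint_singleton_right] at hS'
    rw [insert_eq, insert_eq, union_comm {x}, union_comm {y}]
    exact hS.union hT (by simpa using hx) (by simpa using hy) hST (by simpa using hS'.1)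
      (by simpa using hS'.2) hT'.1 hT'.2

/-- Graphs of large minimum degree contain robustly many copies of `H`. -/
theorem robustlyMany_isCopySet {i : ℕ} (hi : IsSplit H i) {η : ℝ} (hη : 0 < η) (hη1 : η ≤ 1)
    {n : ℕ} {G : SimpleGraph (Fin n)} (hdeg : ∀ x, (1 / 2 + η) * n ≤ ((nbrs G x).card : ℝ))
    (hn : 2 ≤ η * n) :
    RobustlyMany ((η / 2) ^ h * (η / 4) * n - h) (IsCopySet H G) h ∅ := by
  obtain ⟨-, hih, -⟩ := id hi
  have hn0 : (0 : ℝ) ≤ n := Nat.cast_nonneg n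
  set T : Finset (Fin n) := {u | n ≤ 2 * (u : ℕ)}
  have hT : η / 4 * n ≤ T.card := by
    have h1 := card_filter_add_card_filter_not (s := (univ : Finset (Fin n)))
      (fun u : Fin n => n ≤ 2 * (u : ℕ))
    have h2 := two_mul_card_lower_half_le (n := n)
    rw [card_univ, Fintype.card_fin] at h1
    simp only [not_le] at h1
    have h3 : (n : ℝ) ≤ 2 * T.card + 1 := by
      have : n ≤ 2 * T.card + 1 := by simp only [T]; omega
      exact_mod_cast this
    have h4 : η * n ≤ n := mul_le_of_le_one_left hn0 hη1
    linarith
  have hpow : (η / 2) ^ h ≤ (η / 2) ^ i :=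
    pow_le_pow_of_le_one (by positivity) (by linarith) hih.le
  have hpow1 : (η / 2) ^ h ≤ η / 2 := pow_le_of_le_one (by positivity) (by linarith) (by omega)
  have hpow0 : 0 ≤ (η / 2) ^ h := by positivity
  have hcast : ((h - i : ℕ) : ℝ) + i = h := by exact_mod_cast (by omega : h - i + i = h)
  have hi0 : (0 : ℝ) ≤ (h - i : ℕ) := Nat.cast_nonneg _
  have key := RobustlyMany.bipartite T (nbrsLeft G) (c := η / 2)
    (t := (η / 2) ^ h * (η / 4) * n - h) (by positivity) (by linarith)
    (fun u hu => by
      have := card_nbrsLeft_ge hdeg (mem_filter.1 hu).2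
      rw [Fintype.card_fin]
      linarith) i (h - i)
    (by
      rw [Fintype.card_fin]
      have : (η / 2) ^ h * (η / 4) * n ≤ η / 2 * n := by
        gcongr
        nlinarith
      linarith)
    (by
      have : (η / 2) ^ h * (η / 4) * n ≤ (η / 2) ^ i * T.card := by
        rw [mul_assoc]; gcongr
      linarith)
  rw [show i + (h - i) = h by omega] at key
  refine key.mono le_rfl ?_
  rintro S - ⟨A, Q, -, rfl, hA, hQ, -, hAQ⟩
  refine hi.isCopySet hA hQ fun x hx y hy => ?_
  have := hAQ y hy hx
  rw [mem_nbrsLeft] at this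
  exact ⟨this.1, this.2.symm⟩

/-- In a graph of large minimum degree, each set of `h` vertices has robustly many absorbing
sets. -/
theorem exists_absorbers {i : ℕ} (hi : IsSplit H i) {η : ℝ} (hη : 0 < η) (hη1 : η ≤ 1) :
    ∃ τ : ℝ, 0 < τ ∧ ∃ s, 0 < s ∧ ∃ n₀ : ℕ, ∀ n, n₀ ≤ n → ∀ G : SimpleGraph (Fin n),
      (∀ x, (1 / 2 + η) * n ≤ ((nbrs G x).card : ℝ)) → ∀ W : Finset (Fin n), W.card = h →
      RobustlyMany (τ * n) (fun S => IsAbsorbingFor H G S W ∧ Disjoint S W) s ∅ := by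
  obtain ⟨τ, hτ, s, n₀, hex⟩ := exists_exchange hi hη hη1
  set β : ℝ := min ((η / 2) ^ h * (η / 4)) τ with hβ
  have hβ0 : 0 < β := by positivity
  set C : ℝ := h * (s + 2) + 2 * h with hC
  obtain ⟨n₁, hn₁⟩ := exists_nat_ge (max (2 * C / β) (2 / η))
  refine ⟨β / 2, by positivity, h + h * s, by have := hi.2.1; omega, max n₀ n₁, fun n hn G hdeg W hW => ?_⟩
  have hn' : max (2 * C / β) (2 / η) ≤ (n : ℝ) :=
    hn₁.trans (by exact_mod_cast (le_max_right _ _).trans hn)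
  rw [max_le_iff, div_le_iff₀ hβ0, div_le_iff₀ hη] at hn'
  have hn0 : (0 : ℝ) ≤ n := Nat.cast_nonneg n
  have hβ1 : β * n ≤ (η / 2) ^ h * (η / 4) * n := by gcongr; exact min_le_left _ _
  have hβ2 : β * n ≤ τ * n := by gcongr; exact min_le_right _ _
  have hhs : (0 : ℝ) ≤ h * (s + 2) := by positivity
  have hh0 : (0 : ℝ) ≤ h := by positivity
  have h1 := (robustlyMany_isCopySet hi hη hη1 hdeg (by linarith)).avoid (disjoint_empty_left W)
  rw [hW] at h1
  refine (h1.bind (t := β / 2 * n) (t₂ := τ * n - h * (s + 2) - h) (by linarith) (by linarith)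
    (Q := fun T S => IsExchange H G W T S) fun T _ hT => ?_).mono le_rfl ?_
  · exact (exchange_sets (hex n ((le_max_left _ _).trans hn) G hdeg) h hW hT.1.card).mono
      (by linarith) fun _ _ h => h
  · rintro B - ⟨T, S, hTS, rfl, ⟨hT, hTW⟩, hS⟩
    refine ⟨⟨?_, ?_⟩, disjoint_union_left.2 ⟨hTW, hS.1⟩⟩
    · rw [union_comm]; exact hS.4
    · rw [union_assoc]
      exact hT.hasPerfectTilingOn.union hS.3 (disjoint_union_right.2 ⟨hTS, hTW⟩)

end Absorbers

section Family

open Classical in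
/-- If each `W ∈ Ω` admits robustly many sets with property `P W`, there is a small disjoint family
of sets which contains many sets with property `P W`, for all `W` simultaneously. -/
theorem exists_disjoint_family {V ι : Type*} [Fintype V] [DecidableEq V] (hV : 0 < Fintype.card V)
    {Ω : Finset ι} {P : ι → Finset V → Prop} {t : ℝ} {s : ℕ} (hs : 0 < s) (ht : 0 ≤ t)
    (hΩ : ∀ W ∈ Ω, RobustlyMany t (P W) s ∅) (N : ℕ) (hN : (N : ℝ) * s ≤ t / 2)
    {c : ℝ} (hc : c = (t / 2 / Fintype.card V) ^ s) (hc2 : c ≤ 2) :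
    ∃ F : Finset (Finset V), (F : Set (Finset V)).PairwiseDisjoint id ∧
      (∀ B ∈ F, ∃ W ∈ Ω, P W B) ∧ ((F.biUnion id).card : ℝ) ≤ N * s ∧
      ∑ W ∈ Ω, (1 / 2 : ℝ) ^ #{B ∈ F | P W B} ≤ (1 - c / 2) ^ N * Ω.card := by
  induction N with
  | zero => exact ⟨∅, by simp⟩
  | succ N ih =>
    have hc0 : 0 ≤ c := by rw [hc]; positivity
    have hs0 : (0 : ℝ) ≤ s := Nat.cast_nonneg s
    push_cast at hN
    obtain ⟨F, hF1, hF2, hF3, hF4⟩ := ih (by linarith)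
    set U := F.biUnion id with hU
    set wt : ι → ℝ := fun W => (1 / 2 : ℝ) ^ #{B ∈ F | P W B} with hwt
    have hwt0 : ∀ W, 0 ≤ wt W := fun W => by positivity
    have hwt_sum : 0 ≤ ∑ W ∈ Ω, wt W := sum_nonneg fun W _ => hwt0 W
    have hnext : (1 - c / 2) * ∑ W ∈ Ω, wt W ≤ (1 - c / 2) ^ (N + 1) * Ω.card := by
      rw [pow_succ']
      rw [mul_assoc]
      exact mul_le_mul_of_nonneg_left hF4 (by linarith)
    obtain ⟨Q, hQ⟩ : ∃ Q : ι → Finset V → Prop, ∀ W B,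
      Q W B ↔ (P W B ∧ Disjoint B U) ∧ B.card = s := ⟨_, fun _ _ => Iff.rfl⟩
    obtain ⟨B, hB⟩ := RobustlyMany.exists_averaging (t := t / 2) (A := ∅) (s := s)
      (P := Q) (by positivity) wt hwt0 Ω hV
      fun W hW => ((hΩ W hW).avoid (disjoint_empty_left U)).mono (by linarith)
        fun B hB h => (hQ W B).2 ⟨h, by simpa using hB⟩
    rw [← hc] at hB
    by_cases hex : ∃ W ∈ Ω, (P W B ∧ Disjoint B U) ∧ B.card = s
    · obtain ⟨W₀, hW₀, ⟨hW₀P, hBU⟩, hBs⟩ := hex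
      have hBF : B ∉ F := by
        intro hBF
        have h1 : Disjoint B B := hBU.mono_right (subset_biUnion_of_mem id hBF)
        rw [disjoint_self_iff_empty] at h1
        rw [h1, card_empty] at hBs
        omega
      refine ⟨insert B F, ?_, ?_, ?_, ?_⟩
      · rw [coe_insert, Set.pairwiseDisjoint_insert_of_notMem (by simpa using hBF)]
        refine ⟨hF1, fun C hC => ?_⟩
        exact hBU.mono_right (subset_biUnion_of_mem id hC)
      · intro C hC
        rcases mem_insert.1 hC with rfl | hC
        exacts [⟨W₀, hW₀, hW₀P⟩, hF2 C hC]
      · rw [biUnion_insert, id]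
        have : ((B ∪ U).card : ℝ) ≤ B.card + U.card := by exact_mod_cast card_union_le _ _
        rw [hBs] at this
        push_cast
        linarith
      · refine le_trans ?_ hnext
        have h1 : ∀ W, (1 / 2 : ℝ) ^ #{C ∈ insert B F | P W C} =
            wt W - if P W B then wt W / 2 else 0 := by
          intro W
          rw [filter_insert]
          split_ifs with h
          · rw [card_insert_of_notMem fun h' => hBF (mem_filter.1 h').1, pow_succ, hwt]
            ring
          · rw [sub_zero]
        simp_rw [h1]
        rw [sum_sub_distrib, ← sum_filter, ← sum_div]
        have h2 : c * ∑ W ∈ Ω, wt W ≤ ∑ W ∈ Ω with P W B, wt W := by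
          refine hB.trans (sum_le_sum_of_subset_of_nonneg (fun W hW => ?_) fun W _ _ => hwt0 W)
          rw [mem_filter, hQ] at hW
          exact mem_filter.2 ⟨hW.1, hW.2.1.1⟩
        linarith
    · have hB' : c * ∑ W ∈ Ω, wt W ≤ 0 :=
        hB.trans (sum_eq_zero fun W hW => absurd ⟨W, (mem_filter.1 hW).1, (hQ W B).1 (mem_filter.1 hW).2⟩ hex).le
      refine ⟨F, hF1, hF2, ?_, ?_⟩
      · push_cast; linarith
      · refine le_trans ?_ hnext
        linarith

theorem eventually_pow_mul_lt_one (h : ℕ) {ζ : ℝ} (hζ : 0 < ζ) :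
    ∀ᶠ n : ℕ in Filter.atTop, ∀ r : ℕ, ζ * n ≤ r → (n : ℝ) ^ h * (1 / 2 : ℝ) ^ r < 1 := by
  have hρ1 : (1 / 2 : ℝ) ^ ζ < 1 := Real.rpow_lt_one (by norm_num) (by norm_num) hζ
  have hρ0 : (0 : ℝ) ≤ (1 / 2 : ℝ) ^ ζ := by positivity
  filter_upwards [(tendsto_pow_const_mul_const_pow_of_lt_one h hρ0 hρ1).eventually_lt_const
    one_pos] with n hn r hr
  refine lt_of_le_of_lt ?_ hn
  gcongr
  rw [← Real.rpow_natCast, ← Real.rpow_natCast, ← Real.rpow_mul (by norm_num)]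
  exact Real.rpow_le_rpow_of_exponent_ge (by norm_num) (by norm_num) hr

open Classical in
/-- A graph of large minimum degree has a small disjoint family of tileable sets such that each set
of `h` vertices is absorbed by linearly many members of the family. -/
theorem exists_absorbing_family {h : ℕ} {H : SimpleGraph (Fin h)} {i : ℕ} (hi : IsSplit H i)
    {η κ : ℝ} (hη : 0 < η) (hη1 : η ≤ 1) (hκ : 0 < κ) :
    ∃ ζ : ℝ, 0 < ζ ∧ ∃ n₀ : ℕ, ∀ n, n₀ ≤ n → ∀ G : SimpleGraph (Fin n),
      (∀ x, (1 / 2 + η) * n ≤ ((nbrs G x).card : ℝ)) → ∃ F : Finset (Finset (Fin n)),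
      (F : Set (Finset (Fin n))).PairwiseDisjoint id ∧ (∀ B ∈ F, HasPerfectTilingOn H G B) ∧
      ((F.biUnion id).card : ℝ) ≤ κ * n ∧
      ∀ W : Finset (Fin n), W.card = h → ζ * n ≤ (#{B ∈ F | IsAbsorbingFor H G B W} : ℝ) := by
  obtain ⟨τ', hτ', s, hs, n₀, habs⟩ := exists_absorbers hi hη hη1
  obtain ⟨τ, hτ, hττ', hτ1⟩ : ∃ τ, 0 < τ ∧ τ ≤ τ' ∧ τ ≤ 1 :=
    ⟨min τ' 1, by positivity, min_le_left _ _, min_le_right _ _⟩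
  set c : ℝ := (τ / 2) ^ s with hc
  have hc0 : 0 < c := by positivity
  have hc1 : c ≤ 1 := pow_le_one₀ (by positivity) (by linarith)
  obtain ⟨K, hK⟩ := exists_pow_lt_of_lt_one (show (0 : ℝ) < 1 / 4 by norm_num)
    (show 1 - c / 2 < 1 by linarith)
  have hs0 : (0 : ℝ) < s := by exact_mod_cast hs
  have hK0 : (0 : ℝ) < K := by
    rcases Nat.eq_zero_or_pos K with rfl | h
    · norm_num at hK
    · exact_mod_cast h
  set ζ : ℝ := min (τ / 2) κ / (2 * K * s) with hζ
  have hζ0 : 0 < ζ := by positivity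
  have hζK : 2 * K * s * ζ = min (τ / 2) κ := by rw [hζ]; field_simp
  obtain ⟨n₁, hn₁⟩ := Filter.eventually_atTop.1 (eventually_pow_mul_lt_one h hζ0)
  obtain ⟨n₂, hn₂⟩ := exists_nat_ge (1 / ζ)
  refine ⟨ζ, hζ0, max (max n₀ n₁) (max n₂ 1), fun n hn G hdeg => ?_⟩
  simp only [max_le_iff] at hn
  obtain ⟨⟨hn0, hn1⟩, hn2, hn3⟩ := hn
  have hnpos : (0 : ℝ) < n := by exact_mod_cast hn3
  have hζn : 1 ≤ ζ * n := by
    have : 1 / ζ ≤ n := hn₂.trans (by exact_mod_cast hn2)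
    rwa [div_le_iff₀ hζ0, mul_comm] at this
  set r := ⌈ζ * n⌉₊ with hr
  have hr1 : ζ * n ≤ r := Nat.le_ceil _
  have hr2 : (r : ℝ) ≤ 2 * ζ * n := by
    have := Nat.ceil_lt_add_one (show 0 ≤ ζ * n by positivity)
    linarith
  have hN : ((K * r : ℕ) : ℝ) * s ≤ min (τ / 2) κ * n := by
    rw [← hζK]
    push_cast
    calc (K : ℝ) * r * s ≤ K * (2 * ζ * n) * s := by gcongr
      _ = _ := by ring
  obtain ⟨F, hF1, hF2, hF3, hF4⟩ := exists_disjoint_family (V := Fin n) (t := τ * n) (c := c)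
    (Ω := powersetCard h univ) (P := fun W B => IsAbsorbingFor H G B W) (by
      rw [Fintype.card_fin]; exact hn3) hs
    (by positivity)
    (fun W hW => (habs n hn0 G hdeg W (mem_powersetCard.1 hW).2).mono (by gcongr)
      fun _ _ h => h.1) (K * r)
    (hN.trans (by
      have := min_le_left (τ / 2) κ
      rw [mul_div_right_comm]
      gcongr)) (by
      rw [hc, Fintype.card_fin]
      congr 1
      field_simp) (by linarith)
  refine ⟨F, hF1, fun B hB => ?_, hF3.trans (hN.trans ?_), fun W hW => ?_⟩
  · obtain ⟨W, -, hW⟩ := hF2 B hB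
    exact hW.1
  · gcongr
    exact min_le_right _ _
  · have hW' : W ∈ powersetCard h (univ : Finset (Fin n)) := mem_powersetCard.2 ⟨subset_univ _, hW⟩
    have h1 : (1 / 2 : ℝ) ^ #{B ∈ F | IsAbsorbingFor H G B W} ≤
        ∑ W ∈ powersetCard h (univ : Finset (Fin n)),
          (1 / 2 : ℝ) ^ #{B ∈ F | IsAbsorbingFor H G B W} :=
      single_le_sum (f := fun W => (1 / 2 : ℝ) ^ #{B ∈ F | IsAbsorbingFor H G B W})
        (fun _ _ => by positivity) hW'
    have h2 : ((powersetCard h (univ : Finset (Fin n))).card : ℝ) ≤ (n : ℝ) ^ h := by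
      rw [card_powersetCard, card_univ, Fintype.card_fin]
      exact_mod_cast Nat.choose_le_pow n h
    have h3 : (1 - c / 2) ^ (K * r) ≤ (1 / 2 : ℝ) ^ r * (1 / 2 : ℝ) ^ r := by
      rw [pow_mul, ← mul_pow]
      have : (0 : ℝ) ≤ (1 - c / 2) ^ K := pow_nonneg (by linarith) K
      gcongr
      linarith
    have h4 : (1 / 2 : ℝ) ^ #{B ∈ F | IsAbsorbingFor H G B W} ≤ (1 / 2 : ℝ) ^ r := by
      calc _ ≤ (1 - c / 2) ^ (K * r) * ((powersetCard h (univ : Finset (Fin n))).card : ℝ) :=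
            h1.trans hF4
        _ ≤ ((1 / 2 : ℝ) ^ r * (1 / 2 : ℝ) ^ r) * (n : ℝ) ^ h := by gcongr
        _ = (1 / 2 : ℝ) ^ r * ((n : ℝ) ^ h * (1 / 2 : ℝ) ^ r) := by ring
        _ ≤ (1 / 2 : ℝ) ^ r * 1 := by gcongr; exact (hn₁ n hn1 r hr1).le
        _ = _ := mul_one _
    have h5 : r ≤ #{B ∈ F | IsAbsorbingFor H G B W} :=
      (pow_le_pow_iff_right_of_lt_one₀ (by norm_num) (by norm_num)).1 h4
    exact hr1.trans (by exact_mod_cast h5)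

end Family

section Directed

variable {h n : ℕ} {H : SimpleGraph (Fin h)} {G : SimpleGraph (Fin n)}

/-- The neighbours of `x` lying to the right of `x` if `d` is true, and to the left otherwise. -/
noncomputable def dirNbrs (G : SimpleGraph (Fin n)) (d : Bool) (x : Fin n) : Finset (Fin n) :=
  cond d (nbrsRight G x) (nbrsLeft G x)

theorem adj_of_mem_dirNbrs {d : Bool} {x u : Fin n} (hu : u ∈ dirNbrs G d x) : G.Adj x u := by
  cases d
  · exact (mem_nbrsLeft.1 hu).2
  · exact (mem_nbrsRight.1 hu).2

theorem card_nbrs_inter_le (x : Fin n) (L : Finset (Fin n)) :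
    (nbrs G x ∩ L).card ≤ (dirNbrs G false x ∩ L).card + (dirNbrs G true x ∩ L).card := by
  rw [nbrs_eq_union, union_inter_distrib_right]
  exact card_union_le _ _

theorem exists_dirNbrs_inter_ge {x : Fin n} {L : Finset (Fin n)} {a : ℝ}
    (ha : 2 * a ≤ ((nbrs G x ∩ L).card : ℝ)) : ∃ d, a ≤ ((dirNbrs G d x ∩ L).card : ℝ) := by
  by_contra! hcon
  have h1 := hcon false
  have h2 := hcon true
  have h3 : ((nbrs G x ∩ L).card : ℝ) ≤
      (dirNbrs G false x ∩ L).card + (dirNbrs G true x ∩ L).card := by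
    exact_mod_cast card_nbrs_inter_le x L
  linarith

theorem IsSplit.isCopySet_dirNbrs {d : Bool} {r : ℕ} (hr : r ≤ h)
    (hi : IsSplit H (cond d r (h - r))) {Q A : Finset (Fin n)} (hQ : Q.card = r)
    (hA : A.card = h - r) (hQA : ∀ x ∈ Q, A ⊆ dirNbrs G d x) : IsCopySet H G (Q ∪ A) := by
  cases d
  · rw [union_comm]
    refine IsSplit.isCopySet hi hA (by simp only [cond_false]; omega) fun x hx y hy => ?_
    have := mem_nbrsLeft.1 (hQA y hy hx)
    exact ⟨this.1, this.2.symm⟩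
  · exact IsSplit.isCopySet hi hQ hA fun x hx y hy => mem_nbrsRight.1 (hQA x hx hy)

open Classical in
theorem RobustlyMany.exists {V : Type*} [Fintype V] [DecidableEq V] {t : ℝ} (ht : 0 < t)
    {P : Finset V → Prop} {s : ℕ} {A : Finset V} (hA : RobustlyMany t P s A) : ∃ B, P B := by
  induction s generalizing A with
  | zero => exact ⟨A, hA⟩
  | succ s ih =>
    have h1 := ht.trans_le hA
    rw [Nat.cast_pos, card_pos] at h1
    obtain ⟨v, hv⟩ := h1
    exact ih (mem_filter.1 hv).2.2

/-- If many vertices of `L` have many neighbours in `L` in direction `d`, then `L` contains a copy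
of `H`. -/
theorem exists_isCopySet_subset {d : Bool} {r : ℕ} (hr : r ≤ h)
    (hi : IsSplit H (cond d r (h - r))) {c : ℝ} (hc : 0 ≤ c) (hc1 : c ≤ 1)
    (hn : h + 1 ≤ c ^ (h + 1) * n) {L T : Finset (Fin n)} (hTL : T ⊆ L)
    (hT : 2 * c * n ≤ T.card) (hN : ∀ x ∈ T, 2 * c * n ≤ ((dirNbrs G d x ∩ L).card : ℝ)) :
    ∃ S ⊆ L, IsCopySet H G S := by
  have hn0 : (0 : ℝ) ≤ n := Nat.cast_nonneg n
  have hcard : (((h - r : ℕ) : ℝ)) + r = h := by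
    rw [← Nat.cast_add, Nat.sub_add_cancel hr]
  have hr0 : (0 : ℝ) ≤ r := Nat.cast_nonneg r
  have h1 : c ^ (h + 1) * n ≤ c * n := by
    gcongr
    exact pow_le_of_le_one hc hc1 (by omega)
  have h2 : c ^ (h + 1) * n ≤ c ^ (h - r) * T.card := by
    calc c ^ (h + 1) * n = c ^ h * (c * n) := by ring
      _ ≤ c ^ (h - r) * (2 * c * n) := by
        have : 0 ≤ c * n := by positivity
        gcongr ?_ * ?_
        · exact pow_le_pow_of_le_one hc hc1 (by omega)
        · linarith
      _ ≤ _ := by gcongr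
  obtain ⟨B, A, Q, -, rfl, hA, hQ, hQT, hAN⟩ := (RobustlyMany.bipartite (t := 1) T
    (fun x => dirNbrs G d x ∩ L) hc hc1 (by simpa using hN) (h - r) r
    (by rw [Fintype.card_fin]; linarith) (by linarith)).exists one_pos
  refine ⟨Q ∪ A, union_subset (hQT.trans hTL) ?_, hi.isCopySet_dirNbrs hr hQ hA
    fun x hx => (hAN x hx).trans inter_subset_left⟩
  obtain ⟨x, hx⟩ : Q.Nonempty := by
    rw [← card_pos, hQ]
    have := hi.1; have := hi.2.1
    cases d <;> simp only [cond_false, cond_true] at * <;> omega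
  exact (hAN x hx).trans inter_subset_right

/-- A set containing no copy of `H` spans few edges. -/
theorem sum_card_nbrs_inter_le {r : Bool → ℕ} (hr : ∀ d, r d ≤ h)
    (hi : ∀ d, IsSplit H (cond d (r d) (h - r d))) {c : ℝ} (hc : 0 ≤ c) (hc1 : c ≤ 1)
    (hn : h + 1 ≤ c ^ (h + 1) * n) {L : Finset (Fin n)} (hL : ∀ S ⊆ L, ¬ IsCopySet H G S) :
    ∑ x ∈ L, ((nbrs G x ∩ L).card : ℝ) ≤ 4 * c * n * (n + L.card) := by
  classical
  set T : Bool → Finset (Fin n) :=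
    fun d => L.filter fun x => 2 * c * n ≤ ((dirNbrs G d x ∩ L).card : ℝ) with hT
  have hTc : ∀ d, ((T d).card : ℝ) ≤ 2 * c * n := by
    intro d
    by_contra! hcon
    obtain ⟨S, hS, hS'⟩ := exists_isCopySet_subset (hr d) (hi d) hc hc1 hn (filter_subset _ _)
      hcon.le fun x hx => (mem_filter.1 hx).2
    exact hL S hS hS'
  calc ∑ x ∈ L, ((nbrs G x ∩ L).card : ℝ)
      ≤ ∑ x ∈ L, ((4 * c * n + if x ∈ T false then (n : ℝ) else 0) +
          if x ∈ T true then (n : ℝ) else 0) := by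
        refine sum_le_sum fun x hx => ?_
        have h1 : ((nbrs G x ∩ L).card : ℝ) ≤
            (dirNbrs G false x ∩ L).card + (dirNbrs G true x ∩ L).card := by
          exact_mod_cast card_nbrs_inter_le x L
        have h2 : ((nbrs G x ∩ L).card : ℝ) ≤ n := by
          exact_mod_cast (card_le_univ _).trans_eq (Fintype.card_fin n)
        have h3 : ∀ d, x ∉ T d → ((dirNbrs G d x ∩ L).card : ℝ) ≤ 2 * c * n := by
          intro d hd
          simp only [hT, mem_filter, hx, true_and, not_le] at hd
          exact hd.le
        have h4 : 0 ≤ 4 * c * n := by positivity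
        have h5 : (0 : ℝ) ≤ n := Nat.cast_nonneg n
        split_ifs with hf ht ht
        · linarith
        · linarith
        · linarith
        · linarith [h3 _ hf, h3 _ ht]
    _ = L.card * (4 * c * n) + (T false).card * n + (T true).card * n := by
        rw [sum_add_distrib, sum_add_distrib, sum_const, ← sum_filter, ← sum_filter,
          filter_mem_eq_inter, filter_mem_eq_inter, inter_eq_right.2 (filter_subset _ _),
          inter_eq_right.2 (filter_subset _ _)]
        simp only [sum_const, nsmul_eq_mul, hT]
    _ ≤ L.card * (4 * c * n) + (2 * c * n) * n + (2 * c * n) * n := by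
        gcongr
        · exact hTc false
        · exact hTc true
    _ = _ := by ring

/-- Tiling from a complete directed bipartite pair. -/
theorem exists_tiling_of_complete {d : Bool} {r : ℕ} (hr : r ≤ h)
    (hi : IsSplit H (cond d r (h - r))) (k : ℕ) {Y S : Finset (Fin n)} (hY : k * r ≤ Y.card)
    (hS : k * (h - r) ≤ S.card) (hYS : ∀ y ∈ Y, S ⊆ dirNbrs G d y) :
    ∃ Z ⊆ Y ∪ S, HasPerfectTilingOn H G Z ∧ Z.card = k * h := by
  induction k generalizing Y S with
  | zero => exact ⟨∅, empty_subset _, hasPerfectTilingOn_empty, by simp⟩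
  | succ k ih =>
    rw [Nat.succ_mul] at hY hS
    obtain ⟨Q, hQY, hQ⟩ := exists_subset_card_eq (show r ≤ Y.card by omega)
    obtain ⟨A, hAS, hA⟩ := exists_subset_card_eq (show h - r ≤ S.card by omega)
    obtain ⟨Z, hZ, hZt, hZc⟩ := ih (Y := Y \ Q) (S := S \ A)
      (by rw [card_sdiff_of_subset hQY]; omega) (by rw [card_sdiff_of_subset hAS]; omega)
      fun y hy => sdiff_subset.trans (hYS y (mem_sdiff.1 hy).1)
    have hdYS : Disjoint Y S := disjoint_left.2 fun y hy hyS =>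
      (adj_of_mem_dirNbrs (hYS y hy hyS)).ne rfl
    have hQA : IsCopySet H G (Q ∪ A) :=
      hi.isCopySet_dirNbrs hr hQ hA fun x hx => hAS.trans (hYS x (hQY hx))
    have hd : Disjoint Z (Q ∪ A) := by
      refine disjoint_of_subset_left hZ ?_
      simp only [disjoint_union_left, disjoint_union_right]
      exact ⟨⟨sdiff_disjoint, (hdYS.mono hQY sdiff_subset).symm⟩,
        hdYS.mono sdiff_subset hAS, sdiff_disjoint⟩
    refine ⟨Z ∪ (Q ∪ A), union_subset (hZ.trans ?_) (union_subset_union hQY hAS),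
      hZt.union hQA.hasPerfectTilingOn hd, ?_⟩
    · exact union_subset_union sdiff_subset sdiff_subset
    · rw [card_union_of_disjoint hd, hZc, hQA.card, Nat.succ_mul]

end Directed

section Pattern

variable {V : Type*} [Fintype V] [DecidableEq V]

theorem RobustlyMany.disjoint_subsets {ι : Type*} [DecidableEq ι] (J : Finset ι)
    (N : ι → Finset V) {t : ℝ} (hN : ∀ j ∈ J, t ≤ ((N j).card : ℝ)) (K : ℕ) :
    RobustlyMany (t - J.card * K) (fun B => ∃ S : ι → Finset V, (J : Set ι).PairwiseDisjoint S ∧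
      ∀ j ∈ J, S j ⊆ N j ∧ (S j).card = K ∧ S j ⊆ B) (J.card * K) ∅ := by
  induction J using Finset.induction_on with
  | empty =>
    rw [card_empty, zero_mul]
    exact ⟨fun _ => ∅, by simp, by simp⟩
  | insert a J ha ih =>
    have h1 := ih fun j hj => hN j (mem_insert_of_mem hj)
    have h2 : RobustlyMany (t - K) (fun B => B ⊆ N a ∧ B.card = K) K ∅ :=
      (subsets (N a) K).mono (by linarith [hN a (mem_insert_self a J)])
        fun B hB h => ⟨h, by simpa using hB⟩
    rw [card_insert_of_notMem ha, Nat.succ_mul]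
    refine (bind (Q := fun _ B => B ⊆ N a ∧ B.card = K) ?_ ?_ h1 fun _ _ _ => h2).mono le_rfl ?_
    · push_cast
      linarith [Nat.cast_nonneg (α := ℝ) K]
    · push_cast; linarith
    · rintro B - ⟨S₁, S₂, hd, rfl, ⟨S, hS1, hS2⟩, hN2, hK⟩
      have hne : ∀ j ∈ J, j ≠ a := fun j hj h => ha (h ▸ hj)
      refine ⟨Function.update S a S₂, ?_, ?_⟩
      · rw [coe_insert, Set.pairwiseDisjoint_insert_of_notMem (by simpa using ha)]
        refine ⟨fun i hi j hj hij => ?_, fun j hj => ?_⟩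
        · simp only [Function.onFun, Function.update_of_ne (hne i hi),
            Function.update_of_ne (hne j hj)]
          exact hS1 hi hj hij
        · rw [Function.update_self, Function.update_of_ne (hne j hj)]
          exact (disjoint_of_subset_left (hS2 j hj).2.2 hd).symm
      · intro j hj
        rcases mem_insert.1 hj with rfl | hj
        · rw [Function.update_self]
          exact ⟨hN2, hK, subset_union_right⟩
        · rw [Function.update_of_ne (hne j hj)]
          obtain ⟨h3, h4, h5⟩ := hS2 j hj
          exact ⟨h3, h4, h5.trans subset_union_left⟩

open Classical in
/-- Among linearly many `m`-tuples of large sets with labels, there are `M` tuples with the same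
labels for which the `j`-th sets have `K` common elements, disjointly for different `j`. -/
theorem exists_common_pattern {ι α : Type*} [Fintype α] {m K M : ℕ} {θ ρ : ℝ} (hθ : 0 ≤ θ)
    (hV : 0 < Fintype.card V) (hn1 : (m : ℝ) * K ≤ θ / 2 * Fintype.card V)
    (hn2 : ((2 ^ (m * K) * Fintype.card α) ^ m * M : ℕ) <
      (θ / 2) ^ (m * K) * (ρ * Fintype.card V))
    (Ω : Finset ι) (hΩ : ρ * Fintype.card V ≤ Ω.card) (N : ι → Fin m → Finset V)
    (d : ι → Fin m → α) (hN : ∀ x ∈ Ω, ∀ j, θ * Fintype.card V ≤ ((N x j).card : ℝ)) :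
    ∃ (S : Fin m → Finset V) (d₀ : Fin m → α), (∀ i j, i ≠ j → Disjoint (S i) (S j)) ∧
      (∀ j, (S j).card = K) ∧ ∃ Ω' ⊆ Ω, Ω'.card = M ∧
        ∀ x ∈ Ω', d x = d₀ ∧ ∀ j, S j ⊆ N x j := by
  have hV' : (0 : ℝ) < Fintype.card V := by exact_mod_cast hV
  obtain ⟨Q, hQ⟩ : ∃ Q : ι → Finset V → Prop, ∀ x B, Q x B ↔ (∃ S : Fin m → Finset V,
      (∀ i j, i ≠ j → Disjoint (S i) (S j)) ∧
      ∀ j, S j ⊆ N x j ∧ (S j).card = K ∧ S j ⊆ B) ∧ B.card = m * K := ⟨_, fun _ _ => Iff.rfl⟩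
  obtain ⟨B, hB⟩ := RobustlyMany.exists_averaging (t := θ / 2 * Fintype.card V) (A := ∅)
    (s := m * K) (P := Q) (by positivity) (fun _ => 1) (fun _ => zero_le_one) Ω hV fun x hx => by
      have := RobustlyMany.disjoint_subsets univ (N x) (fun j _ => hN x hx j) K
      rw [card_univ, Fintype.card_fin] at this
      refine this.mono (by linarith) ?_
      rintro B hB ⟨S, hS1, hS2⟩
      refine (hQ x B).2 ⟨⟨S, fun i j hij => hS1 (by simp) (by simp) hij,
        fun j => hS2 j (mem_univ j)⟩, by simpa using hB⟩
  simp only [sum_const, nsmul_eq_mul, mul_one] at hB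
  rw [mul_div_cancel_right₀ _ hV'.ne'] at hB
  have hcard : ((2 ^ (m * K) * Fintype.card α) ^ m * M : ℕ) < #{x ∈ Ω | Q x B} := by
    have : (((2 ^ (m * K) * Fintype.card α) ^ m * M : ℕ) : ℝ) < #{x ∈ Ω | Q x B} := by
      refine hn2.trans_le (le_trans ?_ hB)
      gcongr
    exact_mod_cast this
  have hex : ∀ x, ∃ S : Fin m → Finset V, Q x B → (∀ i j, i ≠ j → Disjoint (S i) (S j)) ∧
      ∀ j, S j ⊆ N x j ∧ (S j).card = K ∧ S j ⊆ B := by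
    intro x
    by_cases hx : Q x B
    · obtain ⟨⟨S, hS⟩, -⟩ := (hQ x B).1 hx
      exact ⟨S, fun _ => hS⟩
    · exact ⟨fun _ => ∅, fun h => absurd h hx⟩
  choose S hS using hex
  obtain ⟨x₀, hx₀⟩ : ({x ∈ Ω | Q x B} : Finset ι).Nonempty := by
    rw [← card_pos]; omega
  have hBc : B.card = m * K := ((hQ x₀ B).1 (mem_filter.1 hx₀).2).2
  obtain ⟨y, hy, hyM⟩ := exists_lt_card_fiber_of_mul_lt_card_of_maps_to
    (s := {x ∈ Ω | Q x B}) (f := fun x j => (S x j, d x j)) (n := M)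
    (t := Fintype.piFinset fun _ : Fin m => B.powerset ×ˢ (univ : Finset α))
    (fun x hx => by
      simp only [Fintype.mem_piFinset, mem_product, mem_powerset, mem_univ, and_true]
      exact fun j => ((hS x (mem_filter.1 hx).2).2 j).2.2)
    (by rwa [Fintype.card_piFinset_const, card_product, card_powerset, hBc, card_univ])
  obtain ⟨Ω', hΩ', hΩ'c⟩ := exists_subset_card_eq hyM.le
  have hmem : ∀ x ∈ Ω', x ∈ Ω ∧ Q x B ∧ ∀ j, S x j = (y j).1 ∧ d x j = (y j).2 := by
    intro x hx
    obtain ⟨h1, h2⟩ := mem_filter.1 (hΩ' hx)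
    refine ⟨(mem_filter.1 h1).1, (mem_filter.1 h1).2, fun j => ?_⟩
    rw [← h2]
    exact ⟨rfl, rfl⟩
  obtain ⟨x₁, hx₁⟩ : ({x ∈ ({x ∈ Ω | Q x B} : Finset ι) | (fun j => (S x j, d x j)) = y} :
    Finset ι).Nonempty := by rw [← card_pos]; omega
  obtain ⟨h1, h2⟩ := mem_filter.1 hx₁
  obtain ⟨h3, h4⟩ := hS x₁ (mem_filter.1 h1).2
  have hy1 : ∀ j, S x₁ j = (y j).1 := fun j => by rw [← h2]
  refine ⟨fun j => (y j).1, fun j => (y j).2, ?_, ?_, Ω', fun x hx => (hmem x hx).1, hΩ'c,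
    fun x hx => ⟨funext fun j => ((hmem x hx).2.2 j).2, fun j => ?_⟩⟩
  · intro i j hij
    simpa only [hy1] using h3 i j hij
  · intro j
    simpa only [hy1] using (h4 j).2.1
  · obtain ⟨-, hQx, hj⟩ := hmem x hx
    change (y j).1 ⊆ N x j
    rw [← (hj j).1]
    exact ((hS x hQx).2 j).1

end Pattern

section Rich

variable {n : ℕ}

open Classical in
/-- If the average of `f` over disjoint `h`-sets is large, many of these sets contain more than
`μ` vertices at which `f` is large. -/
theorem card_rich_ge {h μ : ℕ} (hh : 0 < h) {𝒯 : Finset (Finset (Fin n))}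
    (h𝒯 : ∀ T ∈ 𝒯, T.card = h) (hd : (𝒯 : Set (Finset (Fin n))).PairwiseDisjoint id)
    {f : Fin n → ℝ} {β l : ℝ} (hβ : 0 ≤ β) (hl : 0 < l) (hfl : ∀ v, f v ≤ l)
    (hsum : (μ / h + 2 * β) * n * l ≤ ∑ v ∈ 𝒯.biUnion id, f v) :
    β / h * n ≤ (#{T ∈ 𝒯 | μ + 1 ≤ #{v ∈ T | β * l ≤ f v}} : ℝ) := by
  have hh' : (0 : ℝ) < h := by exact_mod_cast hh
  have hcard : (𝒯.card : ℝ) * h ≤ n := by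
    have h1 : (𝒯.biUnion id).card = 𝒯.card * h := by
      exact (card_biUnion hd).trans (sum_const_nat h𝒯)
    have h2 : (𝒯.biUnion id).card ≤ n := (card_le_univ _).trans_eq (Fintype.card_fin n)
    rw [h1] at h2
    exact_mod_cast h2
  have htile : ∀ T ∈ 𝒯, ∑ v ∈ T, f v ≤ (μ + h * β) * l +
      if μ + 1 ≤ #{v ∈ T | β * l ≤ f v} then h * l else 0 := by
    intro T hT
    have hβl : 0 ≤ β * l := by positivity
    split_ifs with hrich
    · have h1 : ∑ v ∈ T, f v ≤ T.card • l := sum_le_card_nsmul T f l fun v _ => hfl v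
      rw [h𝒯 T hT, nsmul_eq_mul] at h1
      have : 0 ≤ (μ + h * β) * l := by positivity
      linarith
    · have h1 : ∑ v ∈ T, f v ≤ ∑ v ∈ T, (β * l + if β * l ≤ f v then l else 0) := by
        refine sum_le_sum fun v _ => ?_
        split_ifs with hv
        · linarith [hfl v]
        · linarith
      rw [sum_add_distrib, sum_const, ← sum_filter, sum_const, h𝒯 T hT, nsmul_eq_mul,
        nsmul_eq_mul] at h1
      have h2 : (#{v ∈ T | β * l ≤ f v} : ℝ) ≤ μ := by
        exact_mod_cast Nat.lt_succ_iff.1 (not_le.1 hrich)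
      have h3 : (#{v ∈ T | β * l ≤ f v} : ℝ) * l ≤ μ * l := by gcongr
      linarith
  rw [sum_biUnion hd] at hsum
  have h1 := hsum.trans (sum_le_sum htile)
  rw [sum_add_distrib, sum_const, ← sum_filter, sum_const, nsmul_eq_mul, nsmul_eq_mul] at h1
  have h2 : (𝒯.card : ℝ) * ((μ + h * β) * l) ≤ (μ / h + β) * n * l := by
    calc (𝒯.card : ℝ) * ((μ + h * β) * l) = (𝒯.card * h) * ((μ / h + β) * l) := by field_simp
      _ ≤ n * ((μ / h + β) * l) := by gcongr
      _ = _ := by ring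
  have h3 : l * h * (β / h * n) ≤
      l * h * (#{T ∈ 𝒯 | μ + 1 ≤ #{v ∈ T | β * l ≤ f v}} : ℝ) := by
    have : l * h * (β / h * n) = β * n * l := by field_simp
    rw [this]
    linarith
  exact le_of_mul_le_mul_left h3 (by positivity)

end Rich

section Almost

variable {h n : ℕ} {H : SimpleGraph (Fin h)} {G : SimpleGraph (Fin n)}

/-- Copies of `H` having many vertices whose neighbourhoods in the uncovered part follow a common
pattern can be replaced by more copies of `H`. -/
theorem exists_larger_tiling {r : Bool → ℕ} (hr : ∀ d, r d ≤ h)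
    (hi : ∀ d, IsSplit H (cond d (r d) (h - r d))) {m a : ℕ} (ha : ∀ d, a ≤ r d)
    (hm : r true * r false < m * a) {𝒯 𝒯' : Finset (Finset (Fin n))}
    (h𝒯 : ∀ T ∈ 𝒯, IsCopySet H G T) (hd : (𝒯 : Set (Finset (Fin n))).PairwiseDisjoint id)
    {L : Finset (Fin n)} (hL : Disjoint (𝒯.biUnion id) L) (h𝒯' : 𝒯' ⊆ 𝒯)
    (hcard : 𝒯'.card = r true * r false) (v : Finset (Fin n) → Fin m → Fin n)
    (hv : ∀ T ∈ 𝒯', (v T).Injective ∧ ∀ j, v T j ∈ T) (S : Fin m → Finset (Fin n))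
    (hSL : ∀ j, S j ⊆ L) (hSd : ∀ i j, i ≠ j → Disjoint (S i) (S j))
    (hSc : ∀ j, (S j).card = h * h) (d : Fin m → Bool)
    (hvS : ∀ T ∈ 𝒯', ∀ j, S j ⊆ dirNbrs G (d j) (v T j)) :
    ∃ Z ⊆ 𝒯.biUnion id ∪ L, HasPerfectTilingOn H G Z ∧ (𝒯.biUnion id).card < Z.card := by
  have hh : 0 < h := (Nat.zero_le _).trans_lt (hi true).2.1
  set Y : Fin m → Finset (Fin n) := fun j => 𝒯'.image (v · j) with hY
  have heq : ∀ T ∈ 𝒯', ∀ T' ∈ 𝒯', ∀ x, x ∈ T → x ∈ T' → T = T' := by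
    intro T hT T' hT' x hx hx'
    by_contra hne
    exact disjoint_left.1 (hd (h𝒯' hT) (h𝒯' hT') hne) hx hx'
  have hYsub : ∀ j, Y j ⊆ 𝒯'.biUnion id := by
    intro j x hx
    obtain ⟨T, hT, rfl⟩ := mem_image.1 hx
    exact mem_biUnion.2 ⟨T, hT, (hv T hT).2 j⟩
  have hYc : ∀ j, (Y j).card = r true * r false := by
    intro j
    rw [← hcard]
    refine card_image_of_injOn fun T hT T' hT' hTT' => ?_
    have hTT'' : v T j = v T' j := hTT'
    exact heq T hT T' hT' _ ((hv T hT).2 j) (hTT'' ▸ (hv T' hT').2 j)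
  have hYd : ∀ i j, i ≠ j → Disjoint (Y i) (Y j) := by
    intro i j hij
    refine disjoint_left.2 fun x hx hx' => hij ?_
    obtain ⟨T, hT, rfl⟩ := mem_image.1 hx
    obtain ⟨T', hT', hTT'⟩ := mem_image.1 hx'
    have h1 : T = T' := heq T hT T' hT' _ ((hv T hT).2 i) (hTT' ▸ (hv T' hT').2 j)
    subst h1
    exact ((hv T hT).1 hTT').symm
  have hsub : 𝒯'.biUnion id ⊆ 𝒯.biUnion id := biUnion_subset_biUnion_of_subset_left _ h𝒯'
  have hYS : ∀ i j, Disjoint (Y i) (S j) := fun i j =>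
    disjoint_of_subset_left ((hYsub i).trans hsub) (disjoint_of_subset_right (hSL j) hL)
  have hprod : ∀ e, r (!e) * r e = r true * r false := by
    intro e
    cases e
    · rfl
    · exact mul_comm _ _
  have hex : ∀ j, ∃ Z ⊆ Y j ∪ S j, HasPerfectTilingOn H G Z ∧ Z.card = r (!d j) * h := by
    intro j
    refine exists_tiling_of_complete (hr (d j)) (hi (d j)) (r (!d j)) ?_ ?_ ?_
    · rw [hYc, hprod]
    · rw [hSc]
      exact Nat.mul_le_mul (hr _) (Nat.sub_le _ _)
    · intro y hy
      obtain ⟨T, hT, rfl⟩ := mem_image.1 hy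
      exact hvS T hT j
  choose Z hZs hZt hZc using hex
  have hZd : ((univ : Finset (Fin m)) : Set (Fin m)).PairwiseDisjoint Z := by
    intro i _ j _ hij
    refine disjoint_of_subset_left (hZs i) (disjoint_of_subset_right (hZs j) ?_)
    simp only [disjoint_union_left, disjoint_union_right]
    exact ⟨⟨hYd i j hij, (hYS j i).symm⟩, hYS i j, hSd i j hij⟩
  have hrest : HasPerfectTilingOn H G ((𝒯 \ 𝒯').biUnion id) :=
    HasPerfectTilingOn.biUnion (fun T hT => (h𝒯 T (mem_sdiff.1 hT).1).hasPerfectTilingOn)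
      (hd.subset (by simp))
  have hrestd : Disjoint ((𝒯 \ 𝒯').biUnion id) (univ.biUnion Z) := by
    rw [disjoint_biUnion_right]
    intro j _
    refine disjoint_of_subset_right (hZs j) (disjoint_union_right.2 ⟨?_, ?_⟩)
    · refine disjoint_of_subset_right (hYsub j) ?_
      simp only [disjoint_biUnion_left, disjoint_biUnion_right]
      intro T hT T' hT'
      have hne : T' ≠ T := fun h => (mem_sdiff.1 hT').2 (h ▸ hT)
      exact hd (mem_sdiff.1 hT').1 (h𝒯' hT) hne
    · exact disjoint_of_subset_left (biUnion_subset_biUnion_of_subset_left _ sdiff_subset)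
        (disjoint_of_subset_right (hSL j) hL)
  refine ⟨(𝒯 \ 𝒯').biUnion id ∪ univ.biUnion Z, union_subset ?_ ?_,
    hrest.union (HasPerfectTilingOn.biUnion (fun j _ => hZt j) hZd) hrestd, ?_⟩
  · exact (biUnion_subset_biUnion_of_subset_left _ sdiff_subset).trans subset_union_left
  · refine biUnion_subset.2 fun j _ => (hZs j).trans (union_subset_union ?_ (hSL j))
    exact (hYsub j).trans hsub
  · have h1 : (𝒯.biUnion id).card = 𝒯.card * h :=
      (card_biUnion hd).trans (sum_const_nat fun T hT => (h𝒯 T hT).card)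
    have h2 : ((𝒯 \ 𝒯').biUnion id).card = (𝒯.card - r true * r false) * h := by
      rw [← hcard, ← card_sdiff_of_subset h𝒯']
      exact (card_biUnion (hd.subset (by simp))).trans
        (sum_const_nat fun T hT => (h𝒯 T (mem_sdiff.1 hT).1).card)
    have h3 : m * a * h ≤ (univ.biUnion Z).card := by
      rw [card_biUnion hZd]
      calc m * a * h = ∑ _j : Fin m, a * h := by simp [mul_assoc]
        _ ≤ _ := sum_le_sum fun j _ => by
          rw [hZc]
          exact Nat.mul_le_mul_right _ (ha _)
    rw [card_union_of_disjoint hrestd, h1, h2]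
    have h4 : 𝒯.card * h = (𝒯.card - r true * r false) * h + r true * r false * h := by
      rw [← add_mul, Nat.sub_add_cancel (hcard ▸ card_le_card h𝒯')]
    have h5 : r true * r false * h < m * a * h := Nat.mul_lt_mul_of_pos_right hm hh
    omega

theorem sum_card_nbrs_inter_comm (A B : Finset (Fin n)) :
    ∑ x ∈ A, ((nbrs G x ∩ B).card : ℝ) = ∑ x ∈ B, ((nbrs G x ∩ A).card : ℝ) := by
  classical
  have key : ∀ C D : Finset (Fin n), ∑ x ∈ C, ((nbrs G x ∩ D).card : ℝ) =
      ∑ x ∈ C, ∑ y ∈ D, if G.Adj x y then (1 : ℝ) else 0 := by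
    intro C D
    refine sum_congr rfl fun x _ => ?_
    rw [sum_boole]
    congr 2
    ext y
    simp [and_comm]
  rw [key, key, sum_comm]
  simp_rw [G.adj_comm]

theorem eventually_lt_mul_natCast {δ : ℝ} (hδ : 0 < δ) (C : ℝ) :
    ∀ᶠ n : ℕ in Filter.atTop, C < δ * n :=
  (tendsto_natCast_atTop_atTop.const_mul_atTop hδ).eventually_gt_atTop C

open Classical in
/-- Many tiles of a tiling have many vertices of large degree into the uncovered part `L`,
provided that `L` contains no copy of `H`. -/
theorem card_rich_tiles_ge {r : Bool → ℕ} (hr : ∀ d, r d ≤ h)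
    (hi : ∀ d, IsSplit H (cond d (r d) (h - r d))) {μ : ℕ} {η ε : ℝ} (hη : 0 < η) (hη1 : η ≤ 1)
    (hε : 0 < ε) (hε1 : ε ≤ 1) (hn : h + 1 ≤ (ε * η / 32) ^ (h + 1) * n) (hn0 : 0 < n)
    (hdeg : ∀ x, (μ / h + η) * n ≤ ((nbrs G x).card : ℝ)) {𝒯 : Finset (Finset (Fin n))}
    (h𝒯 : ∀ T ∈ 𝒯, IsCopySet H G T) (hd : (𝒯 : Set (Finset (Fin n))).PairwiseDisjoint id)
    {L X : Finset (Fin n)} (hX : ((Xᶜ).card : ℝ) ≤ η / 2 * n) (hXL : X ⊆ 𝒯.biUnion id ∪ L)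
    (hL : ∀ S ⊆ L, ¬ IsCopySet H G S) (hLc : ε * n ≤ L.card) :
    η / 8 / h * n ≤
      (#{T ∈ 𝒯 | μ + 1 ≤ #{v ∈ T | η / 8 * L.card ≤ ((nbrs G v ∩ L).card : ℝ)}} : ℝ) := by
  have hh : 0 < h := (Nat.zero_le _).trans_lt (hi true).2.1
  have hn' : (0 : ℝ) < n := by exact_mod_cast hn0
  have hl : (0 : ℝ) < L.card := lt_of_lt_of_le (by positivity) hLc
  have hc1 : ε * η / 32 ≤ 1 := by
    have : ε * η ≤ 1 := mul_le_one₀ hε1 hη.le hη1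
    linarith
  refine card_rich_ge hh (fun T hT => (h𝒯 T hT).card) hd (by positivity) hl (fun v => ?_) ?_
  · exact_mod_cast card_le_card inter_subset_right
  have h1 := sum_card_nbrs_inter_le (G := G) hr hi (by positivity) hc1 hn hL
  have hLn : (L.card : ℝ) ≤ n := by
    exact_mod_cast (card_le_univ _).trans_eq (Fintype.card_fin n)
  have h2 : 4 * (ε * η / 32) * n * (n + L.card) ≤ η / 4 * n * L.card := by
    have h3 : ε * L.card ≤ 1 * L.card := by gcongr
    have h4 : ε * (n + L.card) ≤ 2 * L.card := by linarith
    calc 4 * (ε * η / 32) * n * (n + L.card) = η / 8 * n * (ε * (n + L.card)) := by ring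
      _ ≤ η / 8 * n * (2 * L.card) := by gcongr
      _ = _ := by ring
  rw [sum_card_nbrs_inter_comm]
  have h5 : ∀ x ∈ L, (μ / h + η / 2) * n ≤
      ((nbrs G x ∩ L).card : ℝ) + (nbrs G x ∩ 𝒯.biUnion id).card := by
    intro x _
    have h6 : nbrs G x ⊆ (nbrs G x ∩ L) ∪ (nbrs G x ∩ 𝒯.biUnion id) ∪ Xᶜ := by
      intro u hu
      by_cases huX : u ∈ X
      · rcases mem_union.1 (hXL huX) with h | h
        · exact mem_union_left _ (mem_union_right _ (mem_inter.2 ⟨hu, h⟩))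
        · exact mem_union_left _ (mem_union_left _ (mem_inter.2 ⟨hu, h⟩))
      · exact mem_union_right _ (mem_compl.2 huX)
    have h7 := (card_le_card h6).trans ((card_union_le _ _).trans
      (Nat.add_le_add_right (card_union_le _ _) _))
    have h8 : ((nbrs G x).card : ℝ) ≤
        (nbrs G x ∩ L).card + (nbrs G x ∩ 𝒯.biUnion id).card + (Xᶜ).card := by exact_mod_cast h7
    linarith [hdeg x]
  have h9 := card_nsmul_le_sum _ _ _ h5
  rw [sum_add_distrib, nsmul_eq_mul] at h9
  linarith

/-- An ordered graph of large minimum degree has an almost perfect tiling, even after deleting a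
few vertices. -/
theorem exists_almost_tiling {r : Bool → ℕ} (hr0 : ∀ d, 0 < r d) (hr : ∀ d, r d ≤ h)
    (hi : ∀ d, IsSplit H (cond d (r d) (h - r d))) {η ε : ℝ} (hη : 0 < η) (hη1 : η ≤ 1)
    (hε : 0 < ε) (hε1 : ε ≤ 1) : ∃ n₀ : ℕ, ∀ n, n₀ ≤ n → ∀ G : SimpleGraph (Fin n),
      (∀ x, ((max (r true) (r false) : ℕ) / h + η) * n ≤ ((nbrs G x).card : ℝ)) →
      ∀ X : Finset (Fin n), ((Xᶜ).card : ℝ) ≤ η / 2 * n →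
      ∃ Z ⊆ X, HasPerfectTilingOn H G Z ∧ ((X \ Z).card : ℝ) ≤ ε * n := by
  classical
  have hh : 0 < h := (Nat.zero_le _).trans_lt (hi true).2.1
  have hh' : (0 : ℝ) < h := by exact_mod_cast hh
  set μ := max (r true) (r false) with hμ
  set θ : ℝ := η * ε / 16 with hθ
  have hθ0 : 0 < θ := by positivity
  have hev := (eventually_lt_mul_natCast (δ := (ε * η / 32) ^ (h + 1)) (by positivity)
    (h + 1)).and ((eventually_lt_mul_natCast (δ := θ / 2) (by positivity)
      ((μ + 1 : ℕ) * (h * h : ℕ))).and ((eventually_lt_mul_natCast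
      (δ := (θ / 2) ^ ((μ + 1) * (h * h)) * (η / 8 / h)) (by positivity)
      (((2 ^ ((μ + 1) * (h * h)) * Fintype.card Bool) ^ (μ + 1) * (r true * r false) : ℕ) : ℝ)).and
      (Filter.eventually_ge_atTop 1)))
  obtain ⟨n₀, hn₀⟩ := Filter.eventually_atTop.1 hev
  refine ⟨n₀, fun n hn G hdeg X hX => ?_⟩
  obtain ⟨hn1, hn2, hn3, hn4⟩ := hn₀ n hn
  obtain ⟨Z, hZ, hmax⟩ := exists_max_image
    ((univ : Finset (Finset (Fin n))).filter fun Z => Z ⊆ X ∧ HasPerfectTilingOn H G Z) card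
    ⟨∅, by simpa using hasPerfectTilingOn_empty⟩
  obtain ⟨hZX, hZt⟩ := (mem_filter.1 hZ).2
  refine ⟨Z, hZX, hZt, ?_⟩
  by_contra! hLc
  have hmax' : ∀ Z' ⊆ X, HasPerfectTilingOn H G Z' → Z'.card ≤ Z.card := fun Z' h1 h2 =>
    hmax Z' (mem_filter.2 ⟨mem_univ _, h1, h2⟩)
  have hL : ∀ S ⊆ X \ Z, ¬ IsCopySet H G S := by
    intro S hS hcopy
    have hd : Disjoint Z S := disjoint_of_subset_right hS disjoint_sdiff
    have := hmax' (Z ∪ S) (union_subset hZX (hS.trans sdiff_subset))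
      (hZt.union hcopy.hasPerfectTilingOn hd)
    rw [card_union_of_disjoint hd, hcopy.card] at this
    omega
  obtain ⟨𝒯, h𝒯, hd, hZe⟩ := hZt
  have hrich := card_rich_tiles_ge hr hi hη hη1 hε hε1 hn1.le hn4 hdeg h𝒯 hd hX
    (by rw [hZe, union_sdiff_of_subset hZX]) hL hLc.le
  set L := X \ Z with hLdef
  set R := 𝒯.filter fun T =>
    μ + 1 ≤ (T.filter fun v => η / 8 * L.card ≤ ((nbrs G v ∩ L).card : ℝ)).card with hR
  have hex : ∀ T, ∃ v : Fin (μ + 1) → Fin n, ∃ d : Fin (μ + 1) → Bool, T ∈ R →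
      (v.Injective ∧ ∀ j, v j ∈ T) ∧ ∀ j, θ * n ≤ ((dirNbrs G (d j) (v j) ∩ L).card : ℝ) := by
    intro T
    by_cases hT : T ∈ R
    · obtain ⟨D, hD, hDc⟩ := exists_subset_card_eq (mem_filter.1 hT).2
      have hDm := fun j => mem_filter.1 (hD (orderEmbOfFin_mem D hDc j))
      have hdir : ∀ j, ∃ d, θ * n ≤ ((dirNbrs G d (D.orderEmbOfFin hDc j) ∩ L).card : ℝ) := by
        intro j
        refine exists_dirNbrs_inter_ge (le_trans ?_ (hDm j).2)
        calc 2 * (θ * n) = η / 8 * (ε * n) := by rw [hθ]; ring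
          _ ≤ _ := by gcongr
      choose d hd using hdir
      exact ⟨D.orderEmbOfFin hDc, d, fun _ =>
        ⟨⟨(D.orderEmbOfFin hDc).injective, fun j => (hDm j).1⟩, hd⟩⟩
    · exact ⟨fun _ => ⟨0, hn4⟩, fun _ => true, fun h => absurd h hT⟩
  choose v d hvd using hex
  obtain ⟨S, d₀, hSd, hSc, 𝒯', h𝒯', hcard, hpat⟩ := exists_common_pattern (V := Fin n)
    (m := μ + 1) (K := h * h) (M := r true * r false) (θ := θ) (ρ := η / 8 / h) hθ0.le
    (by rw [Fintype.card_fin]; exact hn4) (by rw [Fintype.card_fin]; exact hn2.le)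
    (by rw [Fintype.card_fin]; exact hn3.trans_eq (mul_assoc _ _ _)) R (by rw [Fintype.card_fin]; exact hrich)
    (fun T j => dirNbrs G (d T j) (v T j) ∩ L) d
    (fun T hT j => by rw [Fintype.card_fin]; exact (hvd T hT).2 j)
  have hpos : 0 < r true * r false := Nat.mul_pos (hr0 _) (hr0 _)
  obtain ⟨T₀, hT₀⟩ : 𝒯'.Nonempty := by rw [← card_pos, hcard]; exact hpos
  obtain ⟨Z', hZ', hZt', hlt⟩ := exists_larger_tiling hr hi (m := μ + 1)
    (a := min (r true) (r false)) (by
      intro d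
      cases d
      exacts [min_le_right _ _, min_le_left _ _]) (by
      rw [Nat.succ_mul, hμ, max_mul_min]
      exact Nat.lt_add_of_pos_right (lt_min (hr0 _) (hr0 _))) h𝒯 hd (L := L)
    (by rw [hZe]; exact disjoint_sdiff) (h𝒯'.trans (filter_subset _ _)) hcard v
    (fun T hT => (hvd T (h𝒯' hT)).1) S
    (fun j => ((hpat T₀ hT₀).2 j).trans inter_subset_right) hSd hSc d₀ fun T hT j => by
      have := hpat T hT
      rw [← this.1]
      exact (this.2 j).trans inter_subset_left
  rw [hZe] at hZ' hlt
  rw [hLdef, union_sdiff_of_subset hZX] at hZ'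
  exact absurd (hmax' Z' hZ' hZt') (not_le.2 hlt)

end Almost

section Absorb

variable {h n : ℕ} {H : SimpleGraph (Fin h)} {G : SimpleGraph (Fin n)}

open Classical in
/-- A disjoint family containing many absorbers for each `h`-set absorbs any set `W` of `k * h`
further vertices. -/
theorem HasPerfectTilingOn.absorb {k : ℕ} {F : Finset (Finset (Fin n))} {W : Finset (Fin n)}
    (hd : (F : Set (Finset (Fin n))).PairwiseDisjoint id)
    (hF : ∀ B ∈ F, HasPerfectTilingOn H G B) (hFW : Disjoint (F.biUnion id) W)
    (hW : W.card = k * h)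
    (habs : ∀ W₀ ⊆ W, W₀.card = h → k ≤ #{B ∈ F | IsAbsorbingFor H G B W₀}) :
    HasPerfectTilingOn H G (F.biUnion id ∪ W) := by
  induction k generalizing F W with
  | zero =>
    rw [zero_mul, card_eq_zero] at hW
    rw [hW, union_empty]
    exact HasPerfectTilingOn.biUnion hF hd
  | succ k ih =>
    rw [Nat.succ_mul] at hW
    obtain ⟨W₀, hW₀, hW₀c⟩ := exists_subset_card_eq (show h ≤ W.card by omega)
    obtain ⟨B, hB⟩ : ({B ∈ F | IsAbsorbingFor H G B W₀} : Finset (Finset (Fin n))).Nonempty := by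
      rw [← card_pos]
      exact (Nat.succ_pos k).trans_le (habs W₀ hW₀ hW₀c)
    obtain ⟨hBF, hBW⟩ := mem_filter.1 hB
    have hsub : (F.erase B).biUnion id ⊆ F.biUnion id :=
      biUnion_subset_biUnion_of_subset_left _ (erase_subset B F)
    have h1 : HasPerfectTilingOn H G ((F.erase B).biUnion id ∪ (W \ W₀)) := by
      refine ih (hd.subset (by simp)) (fun C hC => hF C (mem_of_mem_erase hC))
        (hFW.mono hsub sdiff_subset) (by rw [card_sdiff_of_subset hW₀]; omega) ?_
      intro W₁ hW₁ hW₁c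
      have h2 := habs W₁ (hW₁.trans sdiff_subset) hW₁c
      rw [filter_erase]
      have := pred_card_le_card_erase (a := B) (s := {B ∈ F | IsAbsorbingFor H G B W₁})
      omega
    have hBsub : B ⊆ F.biUnion id := subset_biUnion_of_mem id hBF
    have h2 : Disjoint ((F.erase B).biUnion id ∪ (W \ W₀)) (B ∪ W₀) := by
      simp only [disjoint_union_left, disjoint_union_right]
      refine ⟨⟨?_, (hFW.mono hBsub sdiff_subset).symm⟩, hFW.mono hsub hW₀, sdiff_disjoint⟩
      rw [disjoint_biUnion_left]
      exact fun C hC => hd (mem_of_mem_erase hC) hBF (ne_of_mem_erase hC)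
    have h3 : (F.erase B).biUnion id ∪ (W \ W₀) ∪ (B ∪ W₀) = F.biUnion id ∪ W := by
      conv_rhs => rw [← insert_erase hBF, biUnion_insert, ← sdiff_union_of_subset hW₀, id]
      ext x
      simp only [mem_union]
      tauto
    rw [← h3]
    exact h1.union hBW.2 h2

/-- An ordered graph of large minimum degree has a perfect tiling. -/
theorem exists_perfectTiling {r : Bool → ℕ} (hr0 : ∀ d, 0 < r d) (hr : ∀ d, r d ≤ h)
    (hi : ∀ d, IsSplit H (cond d (r d) (h - r d))) {η : ℝ} (hη : 0 < η) (hη1 : η ≤ 1) :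
    ∃ n₀ : ℕ, ∀ n, n₀ ≤ n → h ∣ n → ∀ G : SimpleGraph (Fin n),
      (∀ x, ((max (r true) (r false) : ℕ) / h + η) * n ≤ ((nbrs G x).card : ℝ)) →
      (∀ x, (1 / 2 + η) * n ≤ ((nbrs G x).card : ℝ)) → HasPerfectTiling H G := by
  classical
  have hh : 0 < h := (Nat.zero_le _).trans_lt (hi true).2.1
  obtain ⟨ζ, hζ, n₁, habs⟩ := exists_absorbing_family (hi true) hη hη1 (half_pos hη)
  obtain ⟨n₂, halm⟩ := exists_almost_tiling hr0 hr hi hη hη1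
    (lt_min hζ one_pos) (min_le_right ζ 1)
  refine ⟨max n₁ n₂, fun n hn hdvd G hdeg hdeg' => ?_⟩
  obtain ⟨F, hd, hF, hFc, hFabs⟩ := habs n ((le_max_left _ _).trans hn) G hdeg'
  obtain ⟨Z, hZ, hZt, hZc⟩ := halm n ((le_max_right _ _).trans hn) G hdeg (F.biUnion id)ᶜ
    (by rwa [compl_compl])
  set A := F.biUnion id with hA
  set W := Aᶜ \ Z with hW
  have hAt : HasPerfectTilingOn H G A := HasPerfectTilingOn.biUnion hF hd
  have hAW : Disjoint A W := disjoint_of_subset_right sdiff_subset disjoint_compl_right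
  have hcard : A.card + (Z.card + W.card) = n := by
    have h1 : W.card + Z.card = Aᶜ.card := card_sdiff_add_card_eq_card hZ
    have h2 : A.card + Aᶜ.card = n := (card_add_card_compl A).trans (Fintype.card_fin n)
    omega
  obtain ⟨k, hk⟩ : h ∣ W.card := by
    rw [← hcard] at hdvd
    exact (Nat.dvd_add_right hZt.dvd_card).1 ((Nat.dvd_add_right hAt.dvd_card).1 hdvd)
  have hWt : HasPerfectTilingOn H G (A ∪ W) := by
    refine HasPerfectTilingOn.absorb hd hF hAW (hk.trans (mul_comm _ _)) fun W₀ _ hW₀ => ?_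
    have h1 : (k : ℝ) ≤ W.card := by
      rw [hk]
      exact_mod_cast Nat.le_mul_of_pos_left k hh
    have h2 : min ζ 1 * n ≤ ζ * n := by
      gcongr
      exact min_le_left _ _
    have h3 := hFabs W₀ hW₀
    have h4 : (k : ℝ) ≤ (#{B ∈ F | IsAbsorbingFor H G B W₀} : ℝ) := by linarith
    exact_mod_cast h4
  have huniv : A ∪ W ∪ Z = univ := by
    rw [hW, union_assoc, sdiff_union_of_subset hZ, union_compl]
  rw [HasPerfectTiling, ← huniv]
  refine hWt.union hZt (disjoint_union_left.2 ⟨?_, sdiff_disjoint⟩)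
  exact disjoint_of_subset_right hZ disjoint_compl_right

end Absorb

section IntervalChi

variable {h : ℕ} {H : SimpleGraph (Fin h)}

theorem exists_adj_of_not_hasIntervalColoring (hH : ¬ HasIntervalColoring H 1) :
    ∃ a b, a < b ∧ H.Adj a b := by
  by_contra! hcon
  refine hH ⟨fun _ => 0, fun _ _ _ => le_rfl, fun a b hab => ?_⟩
  rcases lt_trichotomy a b with hlt | rfl | hlt
  · exact absurd hab (hcon a b hlt)
  · exact absurd hab (H.loopless.irrefl a)
  · exact absurd hab.symm (hcon b a hlt)

theorem HasIntervalColoring.not_adj_of_lt (hH : HasIntervalColoring H 2) {a b : Fin h}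
    (hab : a < b) (hadj : H.Adj a b) :
    (∀ x y, x ≤ a → y ≤ a → ¬ H.Adj x y) ∧ ∀ x y, b ≤ x → b ≤ y → ¬ H.Adj x y := by
  obtain ⟨c, hmono, hc⟩ := hH
  have h1 := hc a b hadj
  have h2 := hmono hab.le
  refine ⟨fun x y hx hy hxy => hc x y hxy ?_, fun x y hx hy hxy => hc x y hxy ?_⟩
  · have := hmono hx
    have := hmono hy
    omega
  · have := hmono hx
    have := hmono hy
    omega

theorem isSplit_of_not_adj {i : ℕ} (h1 : 1 ≤ i) (h2 : i < h)
    (hl : ∀ a b : Fin h, (a : ℕ) < i → (b : ℕ) < i → ¬ H.Adj a b)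
    (hr : ∀ a b : Fin h, i ≤ (a : ℕ) → i ≤ (b : ℕ) → ¬ H.Adj a b) : IsSplit H i := by
  refine ⟨h1, h2, fun a b hab => ⟨fun ha => ?_, fun hb => ?_⟩⟩
  · by_contra! hb
    exact hl a b ha hb hab
  · by_contra! ha
    exact hr a b ha hb hab

theorem isSplit_alphaPlus (h1 : ¬ HasIntervalColoring H 1) (h2 : HasIntervalColoring H 2) :
    IsSplit H (alphaPlus H 1) := by
  set s : Set ℕ := {k | k ≤ h ∧ ∀ a b : Fin h, 0 + 1 ≤ (a : ℕ) + 1 → (a : ℕ) + 1 ≤ k →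
    0 + 1 ≤ (b : ℕ) + 1 → (b : ℕ) + 1 ≤ k → ¬ H.Adj a b} with hs
  have hα : alphaPlus H 1 = sSup s := by rw [alphaPlus, alphaPlus]
  have hbdd : BddAbove s := ⟨h, fun k hk => hk.1⟩
  obtain ⟨hle, hmem⟩ : sSup s ∈ s :=
    Nat.sSup_mem ⟨0, Nat.zero_le _, fun _ _ _ h => absurd h (Nat.not_succ_le_zero _)⟩ hbdd
  have hedge : ∀ a b : Fin h, a < b → H.Adj a b → (a : ℕ) < sSup s := by
    intro a b hab hadj
    refine le_csSup hbdd ⟨a.2, fun x y _ hx _ hy => (h2.not_adj_of_lt hab hadj).1 x y ?_ ?_⟩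
    · exact Nat.le_of_succ_le_succ hx
    · exact Nat.le_of_succ_le_succ hy
  obtain ⟨a₀, b₀, hab₀, hadj₀⟩ := exists_adj_of_not_hasIntervalColoring h1
  rw [hα]
  refine isSplit_of_not_adj ((Nat.zero_le _).trans_lt (hedge _ _ hab₀ hadj₀)) ?_ ?_ ?_
  · refine lt_of_le_of_ne hle fun heq => ?_
    rw [heq] at hmem
    exact hmem a₀ b₀ (by omega) a₀.2 (by omega) b₀.2 hadj₀
  · exact fun a b ha hb => hmem a b (by omega) ha (by omega) hb
  · intro a b ha hb hab
    rcases lt_or_gt_of_ne hab.ne with hlt | hlt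
    · exact absurd (hedge a b hlt hab) (not_lt.2 ha)
    · exact absurd (hedge b a hlt hab.symm) (not_lt.2 hb)

theorem isSplit_alphaMinus (h1 : ¬ HasIntervalColoring H 1) (h2 : HasIntervalColoring H 2) :
    IsSplit H (alphaMinus H 1 - 1) := by
  set s : Set ℕ := {k | 1 ≤ k ∧ ∀ a b : Fin h, k ≤ (a : ℕ) + 1 → (a : ℕ) + 1 ≤ h + 1 - 1 →
    k ≤ (b : ℕ) + 1 → (b : ℕ) + 1 ≤ h + 1 - 1 → ¬ H.Adj a b} with hs
  have hα : alphaMinus H 1 = sInf s := by rw [alphaMinus, alphaMinus]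
  have hedge' : ∀ a b : Fin h, a < b → H.Adj a b → (b : ℕ) + 1 ∈ s := by
    intro a b hab hadj
    refine ⟨Nat.succ_pos _, fun x y hx _ hy _ => (h2.not_adj_of_lt hab hadj).2 x y ?_ ?_⟩
    · exact Nat.le_of_succ_le_succ hx
    · exact Nat.le_of_succ_le_succ hy
  obtain ⟨a₀, b₀, hab₀, hadj₀⟩ := exists_adj_of_not_hasIntervalColoring h1
  obtain ⟨hle, hmem⟩ : sInf s ∈ s := Nat.sInf_mem ⟨_, hedge' _ _ hab₀ hadj₀⟩
  have hedge : ∀ a b : Fin h, a < b → H.Adj a b → sInf s ≤ (b : ℕ) + 1 := fun a b hab hadj =>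
    Nat.sInf_le (hedge' a b hab hadj)
  rw [hα]
  refine isSplit_of_not_adj ?_ ?_ ?_ ?_
  · by_contra! hlt
    exact hmem a₀ b₀ (by omega) (by omega) (by omega) (by omega) hadj₀
  · have := hedge a₀ b₀ hab₀ hadj₀
    omega
  · intro a b ha hb hab
    rcases lt_or_gt_of_ne hab.ne with hlt | hlt
    · have := hedge a b hlt hab
      omega
    · have := hedge b a hlt hab.symm
      omega
  · exact fun a b ha hb => hmem a b (by omega) (by omega) (by omega) (by omega)

end IntervalChi

theorem perfect_tiling_cases_i_to_iii (h : ℕ) (H : SimpleGraph (Fin h))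
    (hchi : intervalChi H = 2) (η : ℝ) (hη : 0 < η) :
    ∃ n₀ : ℕ, ∀ n : ℕ, n₀ ≤ n → h ∣ n → ∀ G : SimpleGraph (Fin n),
      (∀ v : Fin n, (1 - min (alphaStar2 H) (1 / 2) + η) * n ≤ (odeg G v : ℝ)) →
      HasPerfectTiling H G := by
  have hcol2 : HasIntervalColoring H 2 := by
    have : sInf {k | HasIntervalColoring H k} ∈ {k | HasIntervalColoring H k} :=
      Nat.sInf_mem (Nat.nonempty_of_pos_sInf (hchi.symm ▸ two_pos : 0 < intervalChi H))
    rwa [show sInf {k | HasIntervalColoring H k} = 2 from hchi] at this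
  have hcol1 : ¬ HasIntervalColoring H 1 :=
    Nat.notMem_of_lt_sInf (hchi.symm ▸ one_lt_two : 1 < intervalChi H)
  have hp := isSplit_alphaMinus hcol1 hcol2
  have ha := isSplit_alphaPlus hcol1 hcol2
  set p := alphaMinus H 1 - 1 with hp_def
  set a := alphaPlus H 1 with ha_def
  have hp1 := hp.1
  have hp2 := hp.2.1
  have ha1 := ha.1
  have ha2 := ha.2.1
  have hh : (0 : ℝ) < h := by exact_mod_cast (Nat.zero_le _).trans_lt hp2
  obtain ⟨n₀, hn₀⟩ := exists_perfectTiling (H := H) (r := fun d => cond d p (h - a))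
    (η := min η 1) (by
      rintro (_ | _)
      · exact Nat.sub_pos_of_lt ha2
      · exact hp1) (by
      rintro (_ | _)
      · exact Nat.sub_le _ _
      · exact hp2.le) (by
      rintro (_ | _)
      · simpa [Nat.sub_sub_self ha2.le] using ha
      · exact hp) (lt_min hη one_pos) (min_le_right _ _)
  refine ⟨n₀, fun n hn hdvd G hdeg => hn₀ n hn hdvd G (fun x => ?_) fun x => ?_⟩
  · rw [← odeg_eq_card_nbrs]
    refine le_trans ?_ (hdeg x)
    have hmin : min η 1 ≤ η := min_le_left _ _
    have hα := min_le_left (alphaStar2 H) (1 / 2)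
    gcongr ?_ * _
    suffices h1 : ((max p (h - a) : ℕ) : ℝ) / h ≤ 1 - alphaStar2 H by
      simp only [cond_true, cond_false]
      linarith
    rw [div_le_iff₀ hh, Nat.cast_max]
    refine max_le ?_ ?_
    · have h2 : alphaStar2 H ≤ ((h : ℝ) - alphaMinus H 1 + 1) / h := min_le_right _ _
      rw [le_div_iff₀ hh] at h2
      have h3 : (alphaMinus H 1 : ℝ) = p + 1 := by
        have : alphaMinus H 1 = p + 1 := by omega
        exact_mod_cast this
      linarith
    · have h2 : alphaStar2 H ≤ (a : ℝ) / h := min_le_left _ _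
      rw [le_div_iff₀ hh] at h2
      rw [Nat.cast_sub ha2.le]
      linarith
  · rw [← odeg_eq_card_nbrs]
    refine le_trans ?_ (hdeg x)
    have hmin : min η 1 ≤ η := min_le_left _ _
    have hα := min_le_right (alphaStar2 H) (1 / 2)
    gcongr ?_ * _
    linarith
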